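/- Let Σ = Λ^ℕ carry the metric d. For every ε > 0 there exists a Borel probability measure ν on Σ which is invariant and ergodic for the left shift σ (defined by (σω)ₙ = ω_{n+1}) and satisfies dim_H ν ≥ dim_H Σ − ε, where dim_H ν = inf{dim_H A : A Borel, ν(A) = 1} and all Hausdorff dimensions are computed with respect to d. -/

import Mathlib

open Set Filter MeasureTheory Metric
open scoped ENNReal NNReal

noncomputable section

/-- Composition of the maps of an IFS along a finite word (in order). -/
def compWord {Λ : Type*} (f : Λ → ℝ → ℝ) : List Λ → ℝ → ℝ
  | [] => id
  | i :: w => f i ∘ compWord f w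

/-- The chain-rule derivative of `compWord f w`, expressed via the derivatives `f'`. -/
def wordDeriv {Λ : Type*} (f f' : Λ → ℝ → ℝ) : List Λ → ℝ → ℝ
  | [] => fun _ => 1
  | i :: w => fun x => f' i (compWord f w x) * wordDeriv f f' w x

/-- `‖f_w'‖`: the sup over `[0,1]` of `|f_w'|`. -/
def wordDerivNorm {Λ : Type*} (f f' : Λ → ℝ → ℝ) (w : List Λ) : ℝ :=
  sSup ((fun x => |wordDeriv f f' w x|) '' Icc (0:ℝ) 1)

/-- A self-conformal IFS on `[0,1]`: finitely many uniformly contracting differentiable maps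
with Hölder continuous non-vanishing derivatives. -/
structure ConformalIFS (Λ : Type*) where
  f : Λ → ℝ → ℝ
  f' : Λ → ℝ → ℝ
  mapsTo : ∀ i, MapsTo (f i) (Icc (0:ℝ) 1) (Icc (0:ℝ) 1)
  hasDeriv : ∀ i, ∀ x ∈ Icc (0:ℝ) 1, HasDerivWithinAt (f i) (f' i x) (Icc (0:ℝ) 1) x
  exponent : ℝ
  exponent_pos : 0 < exponent
  holder : ∀ i, ∃ C : ℝ, ∀ x ∈ Icc (0:ℝ) 1, ∀ y ∈ Icc (0:ℝ) 1,
    |f' i x - f' i y| ≤ C * |x - y| ^ exponent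
  nonvanishing : ∀ i, ∀ x ∈ Icc (0:ℝ) 1, f' i x ≠ 0
  ratio : ℝ
  ratio_pos : 0 < ratio
  ratio_lt_one : ratio < 1
  contracting : ∀ i, ∀ x ∈ Icc (0:ℝ) 1, ∀ y ∈ Icc (0:ℝ) 1, |f i x - f i y| ≤ ratio * |x - y|

/-- The open set condition (with an open subset of `[0,1]`) for a conformal IFS. -/
def CoordOSC {Λ : Type*} (F : ConformalIFS Λ) : Prop :=
  ∃ U : Set ℝ, U.Nonempty ∧ U ⊆ Icc 0 1 ∧ (∃ O : Set ℝ, IsOpen O ∧ U = O ∩ Icc 0 1) ∧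
    (∀ i, F.f i '' U ⊆ U) ∧ Pairwise fun i i' => Disjoint (F.f i '' U) (F.f i' '' U)

end
noncomputable section

/-- Generic "longest common prefix" distance on sequences: `0` for equal sequences, and
otherwise the value `val` of the longest common initial segment. -/
noncomputable def rhoDist {Γ : Type*} (val : List Γ → ℝ) (u v : ℕ → Γ) : ℝ := by
  classical
  exact if h : u = v then 0
    else val (List.ofFn fun k : Fin (Nat.find (Function.ne_iff.mp h)) => u k.val)

/-- The Barański distance `d[a,b]` on `Γ^ℕ` for `Γ = A ⊆ Γ₁ × Γ₂`:
`d[a,b]((𝚒₁,𝚓₁),(𝚒₂,𝚓₂)) = max {a_{𝚒₁∧𝚒₂}, b_{𝚓₁∧𝚓₂}}`. -/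
noncomputable def baranskiDist {Γ₁ Γ₂ : Type*} (A : Set (Γ₁ × Γ₂)) (a : Γ₁ → ℝ) (b : Γ₂ → ℝ)
    (ω₁ ω₂ : ℕ → ↥A) : ℝ :=
  max
    (rhoDist (fun L => (L.map a).prod)
      (fun k => ((ω₁ k : Γ₁ × Γ₂)).1) (fun k => ((ω₂ k : Γ₁ × Γ₂)).1))
    (rhoDist (fun L => (L.map b).prod)
      (fun k => ((ω₁ k : Γ₁ × Γ₂)).2) (fun k => ((ω₂ k : Γ₁ × Γ₂)).2))

/-- Hausdorff dimension of a measure: the infimum of Hausdorff dimensions of Borel sets of full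
measure. -/
noncomputable def dimHMeasure {E : Type*} [EMetricSpace E] [MeasurableSpace E]
    (μ : MeasureTheory.Measure E) : ℝ≥0∞ :=
  sInf {s | ∃ B : Set E, MeasurableSet B ∧ μ B = 1 ∧ dimH B = s}

/-- `ν` is the Bernoulli measure associated to the probability vector `p`: it gives each
cylinder the product of the `p`-weights of its letters. -/
def IsBernoulli {Γ₁ Γ₂ : Type*} [Fintype Γ₁] [Fintype Γ₂] (A : Set (Γ₁ × Γ₂))
    (p : Γ₁ × Γ₂ → ℝ) [MeasurableSpace (ℕ → ↥A)] (ν : MeasureTheory.Measure (ℕ → ↥A)) : Prop :=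
  ∀ (m : ℕ) (w : Fin m → ↥A),
    ν {ω | ∀ k : Fin m, ω k.val = w k} = ENNReal.ofReal (∏ k : Fin m, p (w k : Γ₁ × Γ₂))

/-- The symbolic metric `d` on `Λ^ℕ` for a non-linear carpet:
`d((𝚒₁,𝚓₁),(𝚒₂,𝚓₂)) = max {‖f'_{𝚒₁∧𝚒₂}‖, ‖g'_{𝚓₁∧𝚓₂}‖}`. -/
noncomputable def symbolicDist {Λ₁ Λ₂ : Type*} (F : ConformalIFS Λ₁) (G : ConformalIFS Λ₂)
    (A : Set (Λ₁ × Λ₂)) (ω₁ ω₂ : ℕ → ↥A) : ℝ :=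
  max
    (rhoDist (wordDerivNorm F.f F.f')
      (fun k => ((ω₁ k : Λ₁ × Λ₂)).1) (fun k => ((ω₂ k : Λ₁ × Λ₂)).1))
    (rhoDist (wordDerivNorm G.f G.f')
      (fun k => ((ω₁ k : Λ₁ × Λ₂)).2) (fun k => ((ω₂ k : Λ₁ × Λ₂)).2))


theorem ifs_compWord_append {Λ : Type*} (f : Λ → ℝ → ℝ) (w v : List Λ) (x : ℝ) :
    compWord f (w ++ v) x = compWord f w (compWord f v x) := by
  induction w with
  | nil => simp [compWord]
  | cons a w ih => simp [compWord, ih]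

theorem ifs_wordDeriv_append {Λ : Type*} (f f' : Λ → ℝ → ℝ) (w v : List Λ) (x : ℝ) :
    wordDeriv f f' (w ++ v) x = wordDeriv f f' w (compWord f v x) * wordDeriv f f' v x := by
  induction w with
  | nil => simp [wordDeriv]
  | cons a w ih => simp [wordDeriv, ih, ifs_compWord_append, mul_assoc]

theorem ifs_comp_mem {Λ : Type*} (F : ConformalIFS Λ) (w : List Λ) (x : ℝ) (hx : x ∈ Icc (0:ℝ) 1) :
    compWord F.f w x ∈ Icc (0:ℝ) 1 := by
  induction w with
  | nil => simpa [compWord] using hx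
  | cons a w ih => exact F.mapsTo a ih

theorem ifs_comp_lip {Λ : Type*} (F : ConformalIFS Λ) (w : List Λ) (x y : ℝ) (hx : x ∈ Icc (0:ℝ) 1)
    (hy : y ∈ Icc (0:ℝ) 1) :
    |compWord F.f w x - compWord F.f w y| ≤ F.ratio ^ w.length := by
  induction w with
  | nil => simp only [compWord, id, List.length_nil, pow_zero]; rw [abs_le]; constructor <;> linarith [hx.1, hx.2, hy.1, hy.2]
  | cons a w ih =>
    have := F.contracting a _ (ifs_comp_mem F w x hx) _ (ifs_comp_mem F w y hy)
    simp only [compWord, Function.comp, List.length_cons, pow_succ']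
    exact this.trans (mul_le_mul_of_nonneg_left ih F.ratio_pos.le)

theorem ifs_deriv_le {Λ : Type*} (F : ConformalIFS Λ) (i : Λ) (x : ℝ) (hx : x ∈ Icc (0:ℝ) 1) :
    |F.f' i x| ≤ F.ratio := by
  have h := F.hasDeriv i x hx
  rw [hasDerivWithinAt_iff_tendsto_slope] at h
  have hne : (nhdsWithin x (Icc (0:ℝ) 1 \ {x})).NeBot := by
    have h2 : UniqueDiffWithinAt ℝ (Icc (0:ℝ) 1) x := uniqueDiffOn_Icc (by norm_num) x hx
    exact accPt_principal_iff_nhdsWithin.1 h2.accPt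
  refine le_of_tendsto h.abs ?_
  filter_upwards [self_mem_nhdsWithin] with y hy
  have hxy : y - x ≠ 0 := sub_ne_zero.2 (by simpa using hy.2)
  rw [slope_def_field, abs_div, div_le_iff₀ (abs_pos.2 hxy)]
  exact F.contracting i y hy.1 x hx

theorem ifs_deriv_cont {Λ : Type*} (F : ConformalIFS Λ) (i : Λ) : ContinuousOn (F.f' i) (Icc (0:ℝ) 1) := by
  obtain ⟨C, hC⟩ := F.holder i
  intro x hx
  rw [ContinuousWithinAt, tendsto_iff_dist_tendsto_zero]
  have h1 : Tendsto (fun y => C * |y - x| ^ F.exponent) (nhdsWithin x (Icc (0:ℝ) 1)) (nhds 0) := by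
    have : ContinuousAt (fun y : ℝ => C * |y - x| ^ F.exponent) x := by
      refine continuousAt_const.mul (ContinuousAt.rpow_const (by fun_prop) (Or.inr F.exponent_pos.le))
    have h2 := this.tendsto
    simp only [sub_self, abs_zero, Real.zero_rpow F.exponent_pos.ne', mul_zero] at h2
    exact h2.mono_left nhdsWithin_le_nhds
  refine squeeze_zero' (Eventually.of_forall fun _ => dist_nonneg) ?_ h1
  filter_upwards [self_mem_nhdsWithin] with y hy
  exact hC y hy x hx

theorem ifs_lower {Λ : Type*} [Fintype Λ] (F : ConformalIFS Λ) :
    ∃ κ > 0, ∀ i, ∀ x ∈ Icc (0:ℝ) 1, κ ≤ |F.f' i x| := by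
  have h : ∀ i, ∃ κ > 0, ∀ x ∈ Icc (0:ℝ) 1, κ ≤ |F.f' i x| := by
    intro i
    obtain ⟨x, hx, hm⟩ := isCompact_Icc.exists_isMinOn (s := Icc (0:ℝ) 1) ⟨0, by simp⟩
      (f := fun x => |F.f' i x|) (ifs_deriv_cont F i).abs
    exact ⟨_, abs_pos.2 (F.nonvanishing i x hx), fun y hy => hm hy⟩
  choose κ hκ hκ' using h
  rcases isEmpty_or_nonempty Λ with hE | hN
  · exact ⟨1, one_pos, fun i => (hE.false i).elim⟩
  · obtain ⟨j, hj⟩ := Finite.exists_min κ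
    exact ⟨κ j, hκ j, fun i x hx => (hj i).trans (hκ' i x hx)⟩

theorem ifs_distortion {Λ : Type*} [Fintype Λ] (F : ConformalIFS Λ) :
    ∃ D, ∀ w : List Λ, ∀ x ∈ Icc (0:ℝ) 1, ∀ y ∈ Icc (0:ℝ) 1,
      |wordDeriv F.f F.f' w x| ≤ Real.exp D * |wordDeriv F.f F.f' w y| := by
  obtain ⟨κ, hκ, hκ'⟩ := ifs_lower F
  choose C0 hC0 using F.holder
  obtain ⟨C, hCp, hC⟩ : ∃ C ≥ 0, ∀ i, C0 i ≤ C :=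
    ⟨∑ i, |C0 i|, Finset.sum_nonneg fun i _ => abs_nonneg _, fun i =>
      (le_abs_self _).trans (Finset.single_le_sum (f := fun i => |C0 i|)
        (fun i _ => abs_nonneg _) (Finset.mem_univ i))⟩
  set q := F.ratio ^ F.exponent with hq
  have hq0 : 0 ≤ q := Real.rpow_nonneg F.ratio_pos.le _
  have hq1 : q < 1 := Real.rpow_lt_one F.ratio_pos.le F.ratio_lt_one F.exponent_pos
  have key : ∀ w : List Λ, ∀ x ∈ Icc (0:ℝ) 1, ∀ y ∈ Icc (0:ℝ) 1,
      |wordDeriv F.f F.f' w x| ≤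
        Real.exp (C / κ * ∑ k ∈ Finset.range w.length, q ^ k) * |wordDeriv F.f F.f' w y| := by
    intro w x hx y hy
    induction w with
    | nil => simp [wordDeriv]
    | cons a w ih =>
      simp only [wordDeriv, List.length_cons, Finset.sum_range_succ, mul_add, Real.exp_add, abs_mul]
      set X := compWord F.f w x
      set Y := compWord F.f w y
      have hX : X ∈ Icc (0:ℝ) 1 := ifs_comp_mem F w x hx
      have hY : Y ∈ Icc (0:ℝ) 1 := ifs_comp_mem F w y hy
      have hXY : |X - Y| ^ F.exponent ≤ q ^ w.length := by
        calc |X - Y| ^ F.exponent ≤ (F.ratio ^ w.length) ^ F.exponent :=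
              Real.rpow_le_rpow (abs_nonneg _) (ifs_comp_lip F w x y hx hy) F.exponent_pos.le
          _ = q ^ w.length := by
              rw [hq, ← Real.rpow_natCast, ← Real.rpow_mul F.ratio_pos.le, mul_comm, Real.rpow_mul F.ratio_pos.le, Real.rpow_natCast]
      have h1 : |F.f' a X| ≤ |F.f' a Y| + C * q ^ w.length := by
        have := hC0 a X hX Y hY
        have h2 : C0 a * |X - Y| ^ F.exponent ≤ C * q ^ w.length :=
          mul_le_mul (hC a) hXY (Real.rpow_nonneg (abs_nonneg _) _) hCp
        have h3 := abs_sub_abs_le_abs_sub (F.f' a X) (F.f' a Y)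
        linarith
      have h2 : |F.f' a X| ≤ Real.exp (C / κ * q ^ w.length) * |F.f' a Y| := by
        have h3 := Real.add_one_le_exp (C / κ * q ^ w.length)
        have h4 : C * q ^ w.length ≤ C / κ * q ^ w.length * |F.f' a Y| := by
          calc C * q ^ w.length = C / κ * q ^ w.length * κ := by field_simp
            _ ≤ _ := mul_le_mul_of_nonneg_left (hκ' a Y hY) (by positivity)
        calc |F.f' a X| ≤ (C / κ * q ^ w.length + 1) * |F.f' a Y| := by linarith
          _ ≤ _ := mul_le_mul_of_nonneg_right h3 (abs_nonneg _)
      calc |F.f' a X| * |wordDeriv F.f F.f' w x| ≤ _ * _ :=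
            mul_le_mul h2 ih (abs_nonneg _) (by positivity)
        _ = _ := by ring
  refine ⟨C / κ * (1 - q)⁻¹, fun w x hx y hy => (key w x hx y hy).trans ?_⟩
  refine mul_le_mul_of_nonneg_right (Real.exp_le_exp.2 ?_) (abs_nonneg _)
  refine mul_le_mul_of_nonneg_left ?_ (by positivity)
  rw [← tsum_geometric_of_lt_one hq0 hq1]
  exact (summable_geometric_of_lt_one hq0 hq1).sum_le_tsum _ (fun k _ => by positivity)

theorem ifs_bounds {Λ : Type*} [Fintype Λ] (F : ConformalIFS Λ) :
    ∃ c C : ℝ, 0 < c ∧ wordDerivNorm F.f F.f' [] = 1 ∧ (∀ w, 0 < wordDerivNorm F.f F.f' w) ∧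
      (∀ w a, wordDerivNorm F.f F.f' (w ++ [a]) ≤ Real.exp (-c) * wordDerivNorm F.f F.f' w) ∧
      (∀ w v, Real.exp (-C) * wordDerivNorm F.f F.f' w * wordDerivNorm F.f F.f' v ≤
        wordDerivNorm F.f F.f' (w ++ v)) ∧
      (∀ a, Real.exp (-C) ≤ wordDerivNorm F.f F.f' [a]) := by
  obtain ⟨κ, hκ, hκ'⟩ := ifs_lower F
  obtain ⟨D, hD⟩ := ifs_distortion F
  have hle1 : ∀ w : List Λ, ∀ x ∈ Icc (0:ℝ) 1, |wordDeriv F.f F.f' w x| ≤ 1 := by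
    intro w x hx
    induction w with
    | nil => simp [wordDeriv]
    | cons a w ih =>
      simp only [wordDeriv, abs_mul]
      have := ifs_deriv_le F a _ (ifs_comp_mem F w x hx)
      exact mul_le_one₀ (this.trans F.ratio_lt_one.le) (abs_nonneg _) ih
  have hpos : ∀ w : List Λ, ∀ x ∈ Icc (0:ℝ) 1, 0 < |wordDeriv F.f F.f' w x| := by
    intro w x hx
    induction w with
    | nil => simp [wordDeriv]
    | cons a w ih =>
      simp only [wordDeriv, abs_mul]
      exact mul_pos (abs_pos.2 (F.nonvanishing a _ (ifs_comp_mem F w x hx))) ih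
  have h01 : (0:ℝ) ∈ Icc (0:ℝ) 1 := by simp
  have hub : ∀ w : List Λ, ∀ x ∈ Icc (0:ℝ) 1, |wordDeriv F.f F.f' w x| ≤ wordDerivNorm F.f F.f' w := by
    intro w x hx
    refine le_csSup ⟨1, ?_⟩ (mem_image_of_mem _ hx)
    rintro _ ⟨y, hy, rfl⟩; exact hle1 w y hy
  have hne : ∀ w : List Λ, ((fun x => |wordDeriv F.f F.f' w x|) '' Icc (0:ℝ) 1).Nonempty :=
    fun w => ⟨_, mem_image_of_mem _ h01⟩
  have hlb : ∀ (w : List Λ) (b : ℝ), (∀ x ∈ Icc (0:ℝ) 1, |wordDeriv F.f F.f' w x| ≤ b) →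
      wordDerivNorm F.f F.f' w ≤ b := by
    intro w b hb
    refine csSup_le (hne w) ?_
    rintro _ ⟨y, hy, rfl⟩; exact hb y hy
  refine ⟨-Real.log F.ratio, max D (-Real.log κ), ?_, ?_, ?_, ?_, ?_, ?_⟩
  · have := Real.log_neg F.ratio_pos F.ratio_lt_one; linarith
  · refine le_antisymm (hlb _ _ (hle1 _)) ?_
    simpa [wordDeriv] using hub [] 0 h01
  · intro w; exact (hpos w 0 h01).trans_le (hub w 0 h01)
  · intro w a
    rw [neg_neg, Real.exp_log F.ratio_pos]
    refine hlb _ _ fun x hx => ?_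
    rw [ifs_wordDeriv_append, abs_mul, mul_comm]
    refine mul_le_mul ?_ (hub w _ (ifs_comp_mem F _ x hx)) (abs_nonneg _) F.ratio_pos.le
    simpa [wordDeriv, compWord] using ifs_deriv_le F a x hx
  · intro w v
    have h1 : Real.exp (-(max D (-Real.log κ))) ≤ Real.exp (-D) :=
      Real.exp_le_exp.2 (neg_le_neg (le_max_left _ _))
    have hv0 : 0 < wordDerivNorm F.f F.f' v := (hpos v 0 h01).trans_le (hub v 0 h01)
    have hw0 : 0 < wordDerivNorm F.f F.f' w := (hpos w 0 h01).trans_le (hub w 0 h01)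
    have h2 : wordDerivNorm F.f F.f' v ≤ Real.exp D * (wordDerivNorm F.f F.f' w)⁻¹ * wordDerivNorm F.f F.f' (w ++ v) := by
      refine hlb _ _ fun x hx => ?_
      have h3 := hub (w ++ v) x hx
      rw [ifs_wordDeriv_append, abs_mul] at h3
      have h4 : wordDerivNorm F.f F.f' w ≤ Real.exp D * |wordDeriv F.f F.f' w (compWord F.f v x)| :=
        hlb _ _ fun z hz => hD w z hz _ (ifs_comp_mem F v x hx)
      have h5 : wordDerivNorm F.f F.f' w * |wordDeriv F.f F.f' v x| ≤ Real.exp D * wordDerivNorm F.f F.f' (w ++ v) := by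
        calc _ ≤ (Real.exp D * |wordDeriv F.f F.f' w (compWord F.f v x)|) * |wordDeriv F.f F.f' v x| :=
              mul_le_mul_of_nonneg_right h4 (abs_nonneg _)
          _ = Real.exp D * (|wordDeriv F.f F.f' w (compWord F.f v x)| * |wordDeriv F.f F.f' v x|) := by ring
          _ ≤ _ := mul_le_mul_of_nonneg_left h3 (Real.exp_pos _).le
      calc |wordDeriv F.f F.f' v x| = (wordDerivNorm F.f F.f' w)⁻¹ * (wordDerivNorm F.f F.f' w * |wordDeriv F.f F.f' v x|) := by
            field_simp
        _ ≤ (wordDerivNorm F.f F.f' w)⁻¹ * (Real.exp D * wordDerivNorm F.f F.f' (w ++ v)) :=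
            mul_le_mul_of_nonneg_left h5 (by positivity)
        _ = _ := by ring
    calc _ ≤ Real.exp (-D) * wordDerivNorm F.f F.f' w * wordDerivNorm F.f F.f' v := by
          gcongr
      _ ≤ Real.exp (-D) * wordDerivNorm F.f F.f' w * (Real.exp D * (wordDerivNorm F.f F.f' w)⁻¹ * wordDerivNorm F.f F.f' (w ++ v)) := by
          gcongr
      _ = wordDerivNorm F.f F.f' (w ++ v) := by
          rw [Real.exp_neg]; field_simp
  · intro a
    have h1 : Real.exp (-(max D (-Real.log κ))) ≤ κ := by
      rw [← Real.le_log_iff_exp_le hκ]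
      linarith [le_max_right D (-Real.log κ)]
    refine h1.trans ((hκ' a 0 h01).trans ?_)
    simpa [wordDeriv, compWord] using hub [a] 0 h01


/-- Abstract log-contraction along a sequence. -/
structure Wt {Λ Γ : Type*} (π : Λ → Γ) (U : (ℕ → Λ) → ℕ → ℝ) (c C : ℝ) : Prop where
  cpos : 0 < c
  zero : ∀ x, U x 0 = 0
  step : ∀ x n, U x n + c ≤ U x (n + 1)
  sub : ∀ x m n, U x (m + n) ≤ U x m + U (fun k => x (m + k)) n + C
  one : ∀ x, U x 1 ≤ C
  congr : ∀ x y n, (∀ k < n, π (x k) = π (y k)) → U x n = U y n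

/-- The relation: distance at most `exp (-t)`. -/
def Near {Λ Γ₁ Γ₂ : Type*} (π₁ : Λ → Γ₁) (π₂ : Λ → Γ₂) (U₁ U₂ : (ℕ → Λ) → ℕ → ℝ) (t : ℝ)
    (x y : ℕ → Λ) : Prop :=
  ∀ n, (U₁ x n < t → π₁ (x n) = π₁ (y n)) ∧ (U₂ x n < t → π₂ (x n) = π₂ (y n))

/-- Log-contraction of an IFS. -/
def ifsU {Λ Γ : Type*} (F : ConformalIFS Γ) (π : Λ → Γ) (x : ℕ → Λ) (n : ℕ) : ℝ :=
  -Real.log (wordDerivNorm F.f F.f' (List.ofFn fun k : Fin n => π (x k)))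

theorem ofFn_congr_seq {Γ : Type*} (x y : ℕ → Γ) (n : ℕ) (h : ∀ k < n, x k = y k) :
    (List.ofFn fun k : Fin n => x k) = List.ofFn fun k : Fin n => y k := by
  congr 1; ext k; exact h k k.2

theorem ofFn_add_seq {Γ : Type*} (x : ℕ → Γ) (m n : ℕ) :
    (List.ofFn fun k : Fin (m + n) => x k) =
      (List.ofFn fun k : Fin m => x k) ++ List.ofFn fun k : Fin n => x (m + k) := by
  rw [List.ofFn_add]; rfl

theorem ifs_wt {Λ Γ : Type*} [Fintype Γ] (F : ConformalIFS Γ) (π : Λ → Γ) :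
    ∃ c C, Wt π (ifsU F π) c C := by
  obtain ⟨c, C, hc, h0, hpos, hstep, hsub, hone⟩ := ifs_bounds F
  refine ⟨c, C, hc, ?_, ?_, ?_, ?_, ?_⟩
  · intro x; simp [ifsU, h0]
  · intro x n
    have h1 := ofFn_add_seq (fun k => π (x k)) n 1
    have h2 := hstep (List.ofFn fun k : Fin n => π (x k)) (π (x n))
    simp only [ifsU]
    rw [h1]
    simp only [List.ofFn_succ, List.ofFn_zero, Fin.val_zero, add_zero]
    have h3 := Real.log_le_log (hpos _) h2
    rw [Real.log_mul (Real.exp_pos _).ne' (hpos _).ne', Real.log_exp] at h3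
    linarith
  · intro x m n
    have h1 := ofFn_add_seq (fun k => π (x k)) m n
    simp only [ifsU]
    rw [h1]
    have h2 := hsub (List.ofFn fun k : Fin m => π (x k)) (List.ofFn fun k : Fin n => π (x (m + k)))
    have h3 := Real.log_le_log (mul_pos (mul_pos (Real.exp_pos _) (hpos _)) (hpos _)) h2
    rw [Real.log_mul (mul_pos (Real.exp_pos _) (hpos _)).ne' (hpos _).ne',
      Real.log_mul (Real.exp_pos _).ne' (hpos _).ne', Real.log_exp] at h3
    linarith
  · intro x
    simp only [ifsU, List.ofFn_succ, List.ofFn_zero]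
    have h3 := Real.log_le_log (Real.exp_pos _) (hone (π (x 0)))
    rw [Real.log_exp] at h3
    simp only [Fin.val_zero]
    linarith
  · intro x y n h
    simp only [ifsU]
    rw [ofFn_congr_seq (fun k => π (x k)) (fun k => π (y k)) n h]

theorem Wt.mono {Λ Γ : Type*} {π : Λ → Γ} {U : (ℕ → Λ) → ℕ → ℝ} {c C : ℝ} (h : Wt π U c C)
    (x : ℕ → Λ) {m n : ℕ} (hmn : m ≤ n) : U x m ≤ U x n := by
  refine monotone_nat_of_le_succ (f := U x) (fun k => ?_) hmn
  have := h.step x k; have := h.cpos; linarith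

theorem Wt.lower {Λ Γ : Type*} {π : Λ → Γ} {U : (ℕ → Λ) → ℕ → ℝ} {c C : ℝ} (h : Wt π U c C)
    (x : ℕ → Λ) (n : ℕ) : c * n ≤ U x n := by
  induction n with
  | zero => simp [h.zero]
  | succ n ih => have := h.step x n; push_cast; linarith

theorem Wt.cC {Λ Γ : Type*} {π : Λ → Γ} {U : (ℕ → Λ) → ℕ → ℝ} {c C : ℝ} (h : Wt π U c C)
    (x : ℕ → Λ) : c ≤ C := by
  have := h.lower x 1; have := h.one x; simp at *; linarith

theorem Wt.succ_le {Λ Γ : Type*} {π : Λ → Γ} {U : (ℕ → Λ) → ℕ → ℝ} {c C : ℝ} (h : Wt π U c C)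
    (x : ℕ → Λ) (n : ℕ) : U x (n + 1) ≤ U x n + 2 * C := by
  have := h.sub x n 1; have := h.one (fun k => x (n + k)); linarith

theorem Wt.upper {Λ Γ : Type*} {π : Λ → Γ} {U : (ℕ → Λ) → ℕ → ℝ} {c C : ℝ} (h : Wt π U c C)
    (x : ℕ → Λ) (n : ℕ) : U x n ≤ 2 * C * n := by
  induction n with
  | zero => simp [h.zero]
  | succ n ih => have := h.succ_le x n; push_cast; linarith

theorem Wt.enlarge {Λ Γ : Type*} {π : Λ → Γ} {U : (ℕ → Λ) → ℕ → ℝ} {c C c' C' : ℝ} (h : Wt π U c C)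
    (hc : 0 < c') (h1 : c' ≤ c) (h2 : C ≤ C') : Wt π U c' C' where
  cpos := hc
  zero := h.zero
  step x n := by linarith [h.step x n]
  sub x m n := by linarith [h.sub x m n]
  one x := by linarith [h.one x]
  congr := h.congr

theorem Wt.eq_of_near {Λ Γ : Type*} {π : Λ → Γ} {U : (ℕ → Λ) → ℕ → ℝ} {c C t : ℝ} (h : Wt π U c C)
    {x y : ℕ → Λ} (hn : ∀ n, U x n < t → π (x n) = π (y n)) (n : ℕ) (hlt : U x n < t) :
    U y n = U x n :=
  (h.congr x y n fun k hk => hn k ((h.mono x hk.le).trans_lt hlt)).symm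

theorem Wt.near_symm {Λ Γ : Type*} {π : Λ → Γ} {U : (ℕ → Λ) → ℕ → ℝ} {c C t : ℝ} (h : Wt π U c C)
    {x y : ℕ → Λ} (hn : ∀ n, U x n < t → π (x n) = π (y n)) (n : ℕ) (hlt : U y n < t) :
    π (y n) = π (x n) := by
  have key : ∀ m, m ≤ n → U x m < t := by
    intro m
    induction m using Nat.strong_induction_on with
    | _ m ih =>
      intro hm
      rw [h.congr x y m fun k hk => hn k (ih k hk (hk.le.trans hm))]
      exact (h.mono y hm).trans_lt hlt
  exact (hn n (key n le_rfl)).symm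

theorem Near.equivalence {Λ Γ₁ Γ₂ : Type*} {π₁ : Λ → Γ₁} {π₂ : Λ → Γ₂} {U₁ U₂ : (ℕ → Λ) → ℕ → ℝ}
    {c C : ℝ} (h1 : Wt π₁ U₁ c C) (h2 : Wt π₂ U₂ c C) (t : ℝ) : Equivalence (Near π₁ π₂ U₁ U₂ t) where
  refl x n := ⟨fun _ => rfl, fun _ => rfl⟩
  symm h n := ⟨h1.near_symm (fun n => (h n).1) n, h2.near_symm (fun n => (h n).2) n⟩
  trans {x y z} h h' n :=
    ⟨fun hl => ((h n).1 hl).trans ((h' n).1 (by rw [h1.eq_of_near (fun n => (h n).1) n hl]; exact hl)),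
     fun hl => ((h n).2 hl).trans ((h' n).2 (by rw [h2.eq_of_near (fun n => (h n).2) n hl]; exact hl))⟩

theorem Near.mono {Λ Γ₁ Γ₂ : Type*} {π₁ : Λ → Γ₁} {π₂ : Λ → Γ₂} {U₁ U₂ : (ℕ → Λ) → ℕ → ℝ}
    {t t' : ℝ} (htt : t ≤ t') {x y : ℕ → Λ} (h : Near π₁ π₂ U₁ U₂ t' x y) : Near π₁ π₂ U₁ U₂ t x y :=
  fun n => ⟨fun hl => (h n).1 (hl.trans_le htt), fun hl => (h n).2 (hl.trans_le htt)⟩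

theorem Near.swap {Λ Γ₁ Γ₂ : Type*} {π₁ : Λ → Γ₁} {π₂ : Λ → Γ₂} {U₁ U₂ : (ℕ → Λ) → ℕ → ℝ}
    {t : ℝ} {x y : ℕ → Λ} : Near π₁ π₂ U₁ U₂ t x y ↔ Near π₂ π₁ U₂ U₁ t x y :=
  forall_congr' fun _ => and_comm

theorem rhoDist_le_iff {Λ Γ : Type*} [Fintype Γ] (F : ConformalIFS Γ) (π : Λ → Γ) (x y : ℕ → Λ) (t : ℝ) :
    rhoDist (wordDerivNorm F.f F.f') (fun k => π (x k)) (fun k => π (y k)) ≤ Real.exp (-t) ↔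
      ∀ n, ifsU F π x n < t → π (x n) = π (y n) := by
  classical
  obtain ⟨c, C, hW⟩ := ifs_wt F π
  obtain ⟨_, _, _, _, hpos, _⟩ := ifs_bounds F
  unfold rhoDist
  split_ifs with h
  · exact ⟨fun _ n _ => congrFun h n, fun _ => (Real.exp_pos _).le⟩
  · set N := Nat.find (Function.ne_iff.mp h) with hN
    have hNs : π (x N) ≠ π (y N) := Nat.find_spec (Function.ne_iff.mp h)
    have hNm : ∀ m < N, π (x m) = π (y m) := fun m hm => by
      have := Nat.find_min (Function.ne_iff.mp h) hm; simpa using this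
    have hval : wordDerivNorm F.f F.f' (List.ofFn fun k : Fin N => π (x k)) = Real.exp (-(ifsU F π x N)) := by
      simp only [ifsU, neg_neg]; rw [Real.exp_log (hpos _)]
    have hgoal : wordDerivNorm F.f F.f' (List.ofFn fun k : Fin N => (fun k => π (x k)) k.val) ≤ Real.exp (-t) ↔
        t ≤ ifsU F π x N := by
      rw [show (List.ofFn fun k : Fin N => (fun k => π (x k)) k.val) = List.ofFn fun k : Fin N => π (x k) from rfl,
        hval, Real.exp_le_exp, neg_le_neg_iff]
    rw [hgoal]
    constructor
    · intro ht n hn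
      apply hNm
      by_contra hcon
      exact absurd (hW.mono x (not_lt.1 hcon)) (not_le.2 (hn.trans_le ht))
    · intro h'
      by_contra hcon
      exact hNs (h' N (not_le.1 hcon))

theorem symbolicDist_le_iff {Λ₁ Λ₂ : Type} [Fintype Λ₁] [Fintype Λ₂] (F : ConformalIFS Λ₁)
    (G : ConformalIFS Λ₂) (A : Set (Λ₁ × Λ₂)) (x y : ℕ → ↥A) (t : ℝ) :
    symbolicDist F G A x y ≤ Real.exp (-t) ↔
      Near (fun a : ↥A => (a : Λ₁ × Λ₂).1) (fun a : ↥A => (a : Λ₁ × Λ₂).2)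
        (ifsU F fun a : ↥A => (a : Λ₁ × Λ₂).1) (ifsU G fun a : ↥A => (a : Λ₁ × Λ₂).2) t x y := by
  unfold symbolicDist
  rw [max_le_iff, rhoDist_le_iff F (fun a : ↥A => (a : Λ₁ × Λ₂).1), rhoDist_le_iff G (fun a : ↥A => (a : Λ₁ × Λ₂).2)]
  exact forall_and.symm

theorem fro_finite {X : Type*} [Fintype X] (R : ℕ → X → X → Prop)
    (heq : ∀ k, Equivalence (R k)) (hmono : ∀ j k, j ≤ k → ∀ x y, R k x y → R j x y)
    (k0 T : ℕ) (hk0 : k0 ≤ T) (r : ℕ → ℝ) (hr : ∀ k, 0 < r k)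
    (hcov : ∀ ι : Finset (X × ℕ), (∀ p ∈ ι, k0 ≤ p.2 ∧ p.2 ≤ T) →
      (∀ x, ∃ p ∈ ι, R p.2 p.1 x) → 1 ≤ ∑ p ∈ ι, r p.2) :
    ∃ μ : X → ℝ, (∀ x, 0 ≤ μ x) ∧ ∑ x, μ x = 1 ∧
      ∀ k, k0 ≤ k → k ≤ T → ∀ S : Finset X, (∀ x ∈ S, ∀ y ∈ S, R k x y) → ∑ y ∈ S, μ y ≤ r k := by
  classical
  let cl : ℕ → X → Finset X := fun k x => Finset.univ.filter (fun y => R k x y)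
  let S : Set (X → ℝ) := {μ | (∀ x, 0 ≤ μ x) ∧ ∀ k ∈ Set.Icc k0 T, ∀ x, ∑ y ∈ cl k x, μ y ≤ r k}
  have hself : ∀ k x, x ∈ cl k x := fun k x => by simp [cl, (heq k).refl x]
  have hSc : IsCompact S := by
    refine IsCompact.of_isClosed_subset
      (isCompact_univ_pi (s := fun _ : X => Set.Icc (0:ℝ) (r T)) fun _ => isCompact_Icc) ?_ ?_
    · have : S = (⋂ x, {μ : X → ℝ | 0 ≤ μ x}) ∩
          ⋂ k ∈ Set.Icc k0 T, ⋂ x, {μ : X → ℝ | ∑ y ∈ cl k x, μ y ≤ r k} := by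
        ext μ; simp [S]
      rw [this]
      refine IsClosed.inter (isClosed_iInter fun x => isClosed_le continuous_const (continuous_apply x)) ?_
      refine isClosed_biInter fun k _ => isClosed_iInter fun x => isClosed_le (by fun_prop) continuous_const
    · rintro μ ⟨h0, h1⟩ x _
      refine ⟨h0 x, ?_⟩
      refine le_trans ?_ (h1 T ⟨hk0, le_rfl⟩ x)
      exact Finset.single_le_sum (f := μ) (fun y _ => h0 y) (hself T x)
  have hSne : S.Nonempty := ⟨0, by simp [S], fun k _ x => by simpa using (hr k).le⟩
  obtain ⟨μ, hμS, hmax⟩ := hSc.exists_isMaxOn hSne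
    (f := fun μ : X → ℝ => ∑ x, μ x) (by fun_prop)
  have hμ0 := hμS.1
  have hμ1 := hμS.2
  -- saturation
  have hsat : ∀ x, ∃ k, k ∈ Set.Icc k0 T ∧ ∑ y ∈ cl k x, μ y = r k := by
    intro x
    by_contra hcon
    push Not at hcon
    have hlt : ∀ k ∈ Set.Icc k0 T, ∑ y ∈ cl k x, μ y < r k := fun k hk =>
      lt_of_le_of_ne (hμ1 k hk x) (hcon k hk)
    obtain ⟨δ, hδ, hδ'⟩ : ∃ δ > 0, ∀ k ∈ Set.Icc k0 T, ∑ y ∈ cl k x, μ y + δ ≤ r k := by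
      obtain ⟨m, hm, hm'⟩ := Finset.exists_min_image (Finset.Icc k0 T)
        (fun k => r k - ∑ y ∈ cl k x, μ y) ⟨k0, by simp [hk0]⟩
      refine ⟨r m - ∑ y ∈ cl m x, μ y, ?_, ?_⟩
      · have := hlt m (by simpa using hm); linarith
      · intro k hk
        have := hm' k (by simpa using hk); linarith
    have hnew : (μ + Pi.single x δ) ∈ S := by
      refine ⟨fun y => ?_, fun k hk z => ?_⟩
      · have : 0 ≤ (Pi.single x δ : X → ℝ) y := by
          by_cases h : y = x
          · subst h; simp [hδ.le]
          · simp [h]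
        simpa using add_nonneg (hμ0 y) this
      · simp only [Pi.add_apply, Finset.sum_add_distrib, Finset.sum_pi_single']
        split_ifs with h
        · have hcl : cl k z = cl k x := by
            have hzx : R k z x := by simpa [cl] using h
            ext y; simp only [cl, Finset.mem_filter, Finset.mem_univ, true_and]
            exact ⟨fun h' => (heq k).trans ((heq k).symm hzx) h', fun h' => (heq k).trans hzx h'⟩
          rw [hcl]; exact hδ' k hk
        · simpa using hμ1 k hk z
    have := hmax hnew
    simp only [mem_ofPred_eq, Pi.add_apply, Finset.sum_add_distrib, Finset.sum_pi_single',
      Finset.mem_univ, if_true] at this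
    linarith
  let κ : X → ℕ := fun x => Nat.find (hsat x)
  have hκ : ∀ x, κ x ∈ Set.Icc k0 T ∧ ∑ y ∈ cl (κ x) x, μ y = r (κ x) := fun x => Nat.find_spec (hsat x)
  have hκmin : ∀ x k, k ∈ Set.Icc k0 T → ∑ y ∈ cl k x, μ y = r k → κ x ≤ k := fun x k h1 h2 =>
    Nat.find_min' (hsat x) ⟨h1, h2⟩
  have hcleq : ∀ k x z, R k x z → cl k x = cl k z := by
    intro k z x hzx
    ext y; simp only [cl, Finset.mem_filter, Finset.mem_univ, true_and]
    exact ⟨fun h' => (heq k).trans ((heq k).symm hzx) h', fun h' => (heq k).trans hzx h'⟩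
  let rep : ℕ → X → X := fun k x => (Quotient.mk ⟨R k, heq k⟩ x).out
  have hrep : ∀ k x, R k (rep k x) x := fun k x => by
    have := Quotient.mk_out (s := ⟨R k, heq k⟩) x
    exact this
  have hrepeq : ∀ k x y, R k x y → rep k x = rep k y := fun k x y h => by
    have : Quotient.mk ⟨R k, heq k⟩ x = Quotient.mk ⟨R k, heq k⟩ y := Quotient.sound h
    simp only [rep, this]
  let ι : Finset (X × ℕ) := Finset.univ.image (fun x => (rep (κ x) x, κ x))
  have htot : 1 ≤ ∑ x, μ x := by
    have h1 : 1 ≤ ∑ p ∈ ι, r p.2 := by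
      apply hcov
      · intro p hp
        obtain ⟨x, -, rfl⟩ := Finset.mem_image.1 hp
        exact (hκ x).1
      · intro x
        exact ⟨_, Finset.mem_image_of_mem _ (Finset.mem_univ x), hrep _ _⟩
    have h2 : ∑ p ∈ ι, r p.2 = ∑ p ∈ ι, ∑ y ∈ cl p.2 p.1, μ y := by
      refine Finset.sum_congr rfl fun p hp => ?_
      obtain ⟨x, -, rfl⟩ := Finset.mem_image.1 hp
      simp only
      rw [hcleq _ _ _ (hrep (κ x) x)]
      exact (hκ x).2.symm
    have key : ∀ x y z, κ x ≤ κ y → R (κ x) x z → R (κ y) y z →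
        (rep (κ x) x, κ x) = (rep (κ y) y, κ y) := by
      intro x y z hle hx hy
      have hxy : R (κ x) x y := (heq _).trans hx ((heq _).symm (hmono _ _ hle _ _ hy))
      have : κ y ≤ κ x := hκmin y _ (hκ x).1 (by rw [← hcleq _ _ _ hxy]; exact (hκ x).2)
      have he : κ x = κ y := le_antisymm hle this
      rw [← he]
      rw [hrepeq _ _ _ hxy]
    have hdis : (ι : Set (X × ℕ)).PairwiseDisjoint (fun p => cl p.2 p.1) := by
      intro p hp q hq hpq
      obtain ⟨x, -, rfl⟩ := Finset.mem_image.1 (Finset.mem_coe.1 hp)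
      obtain ⟨y, -, rfl⟩ := Finset.mem_image.1 (Finset.mem_coe.1 hq)
      rw [Function.onFun, Finset.disjoint_left]
      intro z hz hz'
      simp only [hcleq _ _ _ (hrep _ _)] at hz hz'
      simp only [cl, Finset.mem_filter, Finset.mem_univ, true_and] at hz hz'
      rcases le_total (κ x) (κ y) with h | h
      · exact hpq (key x y z h hz hz')
      · exact hpq (key y x z h hz' hz).symm
    rw [h2, ← Finset.sum_biUnion hdis] at h1
    exact h1.trans (Finset.sum_le_sum_of_subset_of_nonneg (Finset.subset_univ _) fun y _ _ => hμ0 y)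
  set tot := ∑ x, μ x with htotdef
  have htp : 0 < tot := by linarith
  refine ⟨fun x => μ x / tot, fun x => div_nonneg (hμ0 x) htp.le, ?_, ?_⟩
  · rw [← Finset.sum_div]; exact div_self htp.ne'
  · intro k hk hkT A hA
    rw [← Finset.sum_div]
    rcases A.eq_empty_or_nonempty with rfl | ⟨x, hx⟩
    · simpa using (hr k).le
    have h1 : ∑ y ∈ A, μ y ≤ ∑ y ∈ cl k x, μ y :=
      Finset.sum_le_sum_of_subset_of_nonneg (fun y hy => by simp [cl, hA x hx y hy]) fun y _ _ => hμ0 y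
    have h2 : 0 ≤ ∑ y ∈ A, μ y := Finset.sum_nonneg fun y _ => hμ0 y
    exact (div_le_self h2 htot).trans (h1.trans (hμ1 k ⟨hk, hkT⟩ x))


theorem seq_eventually_coord {Λ Γ₁ Γ₂ : Type*} {π₁ : Λ → Γ₁} {π₂ : Λ → Γ₂} {U₁ U₂ : (ℕ → Λ) → ℕ → ℝ}
    (hinj : Function.Injective fun a => (π₁ a, π₂ a))
    [MetricSpace (ℕ → Λ)] (hd : ∀ t (x y : ℕ → Λ), dist x y ≤ Real.exp (-t) ↔ Near π₁ π₂ U₁ U₂ t x y)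
    (x : ℕ → Λ) (k : ℕ) : ∀ᶠ y in nhds x, y k = x k := by
  set t := max (U₁ x k) (U₂ x k) + 1
  filter_upwards [Metric.closedBall_mem_nhds x (Real.exp_pos (-t))] with y hy
  have h := (hd t x y).1 (by rw [dist_comm]; exact hy) k
  have h1 := h.1 (by have := le_max_left (U₁ x k) (U₂ x k); simp only [t]; linarith)
  have h2 := h.2 (by have := le_max_right (U₁ x k) (U₂ x k); simp only [t]; linarith)
  exact hinj (by simp [h1, h2])

theorem seq_continuous {Λ Γ₁ Γ₂ : Type*} {π₁ : Λ → Γ₁} {π₂ : Λ → Γ₂} {U₁ U₂ : (ℕ → Λ) → ℕ → ℝ}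
    {c C : ℝ} (h1 : Wt π₁ U₁ c C) (h2 : Wt π₂ U₂ c C)
    [MetricSpace (ℕ → Λ)] (hd : ∀ t (x y : ℕ → Λ), dist x y ≤ Real.exp (-t) ↔ Near π₁ π₂ U₁ U₂ t x y)
    {X : Type*} [TopologicalSpace X] (g : X → ℕ → Λ)
    (hg : ∀ x k, ∀ᶠ y in nhds x, g y k = g x k) : Continuous g := by
  rw [continuous_iff_continuousAt]
  intro x
  rw [ContinuousAt, Metric.tendsto_nhds]
  intro ε hε
  obtain ⟨N, hN⟩ := exists_nat_gt ((-Real.log (ε / 2)) / c)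
  rw [div_lt_iff₀ h1.cpos] at hN
  have hall : ∀ᶠ y in nhds x, ∀ k ∈ Finset.range N, g y k = g x k :=
    (Finset.eventually_all _).2 fun k _ => hg x k
  filter_upwards [hall] with y hy
  have : dist (g x) (g y) ≤ Real.exp (-(-Real.log (ε / 2))) := by
    rw [hd]
    intro n
    have key : c * n < -Real.log (ε / 2) → g y n = g x n := fun hlt => by
      apply hy; rw [Finset.mem_range]
      have : c * n < c * N := by linarith
      exact_mod_cast lt_of_mul_lt_mul_left this h1.cpos.le
    exact ⟨fun hl => by rw [key ((h1.lower _ n).trans_lt hl)], fun hl => by rw [key ((h2.lower _ n).trans_lt hl)]⟩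
  rw [neg_neg, Real.exp_log (by positivity), dist_comm] at this
  linarith

/-- concatenation of blocks -/
def blockMap {Λ B : Type*} (n : ℕ) (hn : 0 < n) (b : B → Fin n → Λ) (y : ℕ → B) : ℕ → Λ :=
  fun k => b (y (k / n)) ⟨k % n, Nat.mod_lt _ hn⟩

theorem blockMap_shift {Λ B : Type*} (n : ℕ) (hn : 0 < n) (b : B → Fin n → Λ) (y : ℕ → B) (m k : ℕ) :
    blockMap n hn b y (n * m + k) = blockMap n hn b (fun j => y (m + j)) k := by
  unfold blockMap
  have h1 : (n * m + k) / n = m + k / n := by rw [Nat.mul_add_div hn]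
  have h2 : (n * m + k) % n = k % n := Nat.mul_add_mod _ _ _
  simp only [h1, h2]

theorem bern_zero_one {B : Type*} [MeasurableSpace B] (P : Measure B) [IsProbabilityMeasure P]
    (A : Set (ℕ → B)) (hA : MeasurableSet A) (hinv : (fun (y : ℕ → B) k => y (k + 1)) ⁻¹' A = A) :
    Measure.infinitePi (fun _ : ℕ => P) A = 0 ∨ Measure.infinitePi (fun _ : ℕ => P) A = 1 := by
  have hind : ProbabilityTheory.iIndepFun (fun (i : ℕ) (y : ℕ → B) => y i) (Measure.infinitePi (fun _ : ℕ => P)) :=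
    ProbabilityTheory.iIndepFun_infinitePi (P := fun _ : ℕ => P) (X := fun _ y => y) (fun _ => measurable_id)
  refine ProbabilityTheory.measure_zero_or_one_of_measurableSet_limsup_atTop
    (s := fun i => MeasurableSpace.comap (fun y : ℕ → B => y i) inferInstance) ?_ hind ?_
  · intro i; exact (measurable_pi_apply i).comap_le
  · rw [limsup_eq_iInf_iSup_of_nat, MeasurableSpace.measurableSet_iInf]
    intro n
    have hk : (fun (y : ℕ → B) k => y (k + n)) ⁻¹' A = A := by
      induction n with
      | zero => rfl
      | succ n ih =>
        conv_rhs => rw [← ih, ← hinv]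
        ext y
        simp only [mem_preimage]
        have : (fun k => y (k + (n + 1))) = fun k => y (k + 1 + n) := by ext k; congr 1; ring
        rw [this]
    rw [← hk]
    have hm : @Measurable _ _ (⨆ i ≥ n, MeasurableSpace.comap (fun y : ℕ → B => y i) inferInstance) _
        (fun (y : ℕ → B) k => y (k + n)) := by
      refine @measurable_pi_lambda _ _ _ (_) _ _ fun k => ?_
      refine Measurable.mono (comap_measurable _) ?_ le_rfl
      exact le_iSup₂_of_le (k + n) (Nat.le_add_left _ _) le_rfl
    exact hm hA

theorem block_ergodic {Λ B : Type*} [MeasurableSpace (ℕ → Λ)] [MeasurableSpace B]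
    (P : Measure B) [IsProbabilityMeasure P] (n : ℕ) (hn : 0 < n) (b : B → Fin n → Λ)
    (hσ : Measurable (fun (ω : ℕ → Λ) k => ω (k + 1))) (hΦ : Measurable (blockMap n hn b)) :
    ∃ ν : Measure (ℕ → Λ), IsProbabilityMeasure ν ∧ Ergodic (fun ω k => ω (k + 1)) ν ∧
      ∀ S, MeasurableSet S → ν S = 0 → (Measure.infinitePi (fun _ : ℕ => P)).map (blockMap n hn b) S = 0 := by
  set σ : (ℕ → Λ) → ℕ → Λ := fun ω k => ω (k + 1) with hσdef
  set m := Measure.infinitePi (fun _ : ℕ => P) with hm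
  set ν0 := m.map (blockMap n hn b) with hν0
  have : IsProbabilityMeasure ν0 := Measure.isProbabilityMeasure_map hΦ.aemeasurable
  have hσk : ∀ k, Measurable (σ^[k]) := fun k => hσ.iterate k
  have hσit : ∀ k (ω : ℕ → Λ), σ^[k] ω = fun j => ω (j + k) := by
    intro k
    induction k with
    | zero => intro ω; rfl
    | succ k ih => intro ω; rw [Function.iterate_succ_apply, ih]; ext j; simp only [hσdef]; congr 1
  have hsem : ∀ y : ℕ → B, σ^[n] (blockMap n hn b y) = blockMap n hn b (fun j => y (j + 1)) := by
    intro y; rw [hσit]; ext k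
    have := blockMap_shift n hn b y 1 k
    rw [mul_one, add_comm] at this
    rw [this]; congr 2; ext j; rw [add_comm]
  have hshift : m.map (fun (y : ℕ → B) k => y (k + 1)) = m := by
    have := Measure.map_infinitePi_infinitePi_of_inj (P := fun _ : ℕ => P) (f := fun k : ℕ => k + 1)
      (fun a b h => by simpa using h)
    exact this
  have hinv0 : ν0.map σ^[n] = ν0 := by
    rw [hν0, Measure.map_map (hσk n) hΦ]
    have : σ^[n] ∘ blockMap n hn b = blockMap n hn b ∘ (fun (y : ℕ → B) k => y (k + 1)) := by
      ext y; simp [hsem]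
    rw [this, ← Measure.map_map hΦ (by fun_prop), hshift]
  have hn0 : (n : ℝ≥0∞) ≠ 0 := by exact_mod_cast hn.ne'
  have hnt : (n : ℝ≥0∞) ≠ ∞ := ENNReal.natCast_ne_top n
  set ν : Measure (ℕ → Λ) := (n : ℝ≥0∞)⁻¹ • ∑ k ∈ Finset.range n, ν0.map σ^[k] with hν
  have hνapp : ∀ S, MeasurableSet S → ν S = (n : ℝ≥0∞)⁻¹ * ∑ k ∈ Finset.range n, ν0 (σ^[k] ⁻¹' S) := by
    intro S hS
    simp only [hν, Measure.smul_apply, Measure.finsetSum_apply, smul_eq_mul]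
    congr 1
    exact Finset.sum_congr rfl fun k _ => Measure.map_apply (hσk k) hS
  have hconst : ∀ S, MeasurableSet S → (∀ k, ν0 (σ^[k] ⁻¹' S) = ν0 S) → ν S = ν0 S := by
    intro S hS h
    rw [hνapp S hS]
    simp only [h, Finset.sum_const, Finset.card_range, nsmul_eq_mul]
    rw [← mul_assoc, ENNReal.inv_mul_cancel hn0 hnt, one_mul]
  have hprob : IsProbabilityMeasure ν := ⟨by rw [hconst _ MeasurableSet.univ (fun k => by simp)]; simp⟩
  refine ⟨ν, hprob, ⟨⟨hσ, ?_⟩, ⟨?_⟩⟩, ?_⟩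
  · ext S hS
    rw [Measure.map_apply hσ hS, hνapp _ (hσ hS), hνapp _ hS]
    congr 1
    have h1 : ∀ k, σ^[k] ⁻¹' (σ ⁻¹' S) = σ^[k + 1] ⁻¹' S := by
      intro k; rw [Function.iterate_succ', preimage_comp]
    simp only [h1]
    have h2 := Finset.sum_range_succ (fun k => ν0 (σ^[k] ⁻¹' S)) n
    have h3 := Finset.sum_range_succ' (fun k => ν0 (σ^[k] ⁻¹' S)) n
    have h4 : ν0 (σ^[n] ⁻¹' S) = ν0 (σ^[0] ⁻¹' S) := by
      rw [← Measure.map_apply (hσk n) hS, hinv0]; rfl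
    rw [h2, h4] at h3
    exact ((ENNReal.add_left_inj (measure_ne_top _ _)).1 h3).symm
  · intro S hS hinv
    have hk : ∀ k, σ^[k] ⁻¹' S = S := fun k => Function.IsFixedPt.preimage_iterate hinv k
    have h1 : ν S = ν0 S := hconst S hS fun k => by rw [hk]
    have h2 : ν0 S = m (blockMap n hn b ⁻¹' S) := Measure.map_apply hΦ hS
    have h3 := bern_zero_one P (blockMap n hn b ⁻¹' S) (hΦ hS) (by
      ext y
      simp only [mem_preimage]
      rw [← hsem, ← mem_preimage, hk])
    rw [← hm, ← h2, ← h1] at h3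
    rw [eventuallyConst_set']
    rcases h3 with h | h
    · left; exact ae_eq_empty.2 h
    · right; exact ae_eq_univ.2 ((prob_compl_eq_zero_iff hS).2 h)
  · intro S hS h0
    rw [hνapp S hS, mul_eq_zero] at h0
    rcases h0 with h0 | h0
    · exact absurd h0 (ENNReal.inv_ne_zero.2 hnt)
    · have := (Finset.sum_eq_zero_iff.1 h0) 0 (Finset.mem_range.2 hn)
      exact this


theorem Wt.lt {Λ Γ : Type*} {π : Λ → Γ} {U : (ℕ → Λ) → ℕ → ℝ} {c C : ℝ} (h : Wt π U c C)
    (x : ℕ → Λ) {i N : ℕ} (hi : i < N) : U x i < U x N := by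
  have := h.step x i; have := h.mono x (Nat.succ_le_of_lt hi); have := h.cpos
  simp only [Nat.succ_eq_add_one] at *
  linarith

theorem block_U_le {Λ Γ B : Type*} {π : Λ → Γ} {U : (ℕ → Λ) → ℕ → ℝ} {c C : ℝ} (h : Wt π U c C)
    (n : ℕ) (hn : 0 < n) (b : B → Fin n → Λ) (τ : ℝ)
    (hτ : ∀ i (x : ℕ → Λ), (∀ k : Fin n, x k = b i k) → U x n + C ≤ τ) (y : ℕ → B) (k : ℕ) :
    U (blockMap n hn b y) (n * k) ≤ k * τ := by
  induction k with
  | zero => simp [h.zero]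
  | succ k ih =>
    have h1 := h.sub (blockMap n hn b y) (n * k) n
    have h2 := hτ (y k) (fun j => blockMap n hn b y (n * k + j)) (by
      intro j
      rw [blockMap_shift]
      simp [blockMap, Nat.div_eq_of_lt j.2, Nat.mod_eq_of_lt j.2])
    rw [Nat.mul_succ]; push_cast; linarith

theorem block_ball {Λ Γ₁ Γ₂ B : Type*} {π₁ : Λ → Γ₁} {π₂ : Λ → Γ₂} {U₁ U₂ : (ℕ → Λ) → ℕ → ℝ}
    {c C : ℝ} (h1 : Wt π₁ U₁ c C) (h2 : Wt π₂ U₂ c C)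
    (hinj : Function.Injective fun a => (π₁ a, π₂ a))
    [MeasurableSpace B] [DiscreteMeasurableSpace B] (P : Measure B) [IsProbabilityMeasure P]
    (n : ℕ) (hn : 0 < n) (b : B → Fin n → Λ) (hb : Function.Injective b)
    (τ τ' α β d : ℝ) (hτ0 : 0 < τ) (hττ : τ ≤ τ')
    (hτ : ∀ i (x : ℕ → Λ), (∀ k : Fin n, x k = b i k) → U₁ x n + C ≤ τ ∧ U₂ x n + C ≤ τ')
    (hα : ∀ i, P {i} ≤ ENNReal.ofReal (Real.exp (-α)))
    (hβ : ∀ i, P {j | ∀ k, π₁ (b j k) = π₁ (b i k)} ≤ ENNReal.ofReal (Real.exp (-β)))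
    (hdim : d ≤ (α - β) / τ' + β / τ) (t : ℝ) (ht : 0 ≤ t) (ω : ℕ → Λ) :
    Measure.infinitePi (fun _ : ℕ => P) (blockMap n hn b ⁻¹' {x | Near π₁ π₂ U₁ U₂ t ω x}) ≤
      ENNReal.ofReal (Real.exp (|α - β| + |β|) * Real.exp (-(d * t))) := by
  rcases (blockMap n hn b ⁻¹' {x | Near π₁ π₂ U₁ U₂ t ω x}).eq_empty_or_nonempty with he | ⟨y, hy⟩
  · rw [he]; simp
  have hτ'0 : 0 < τ' := hτ0.trans_le hττ
  set k1 := ⌊t / τ⌋₊ with hk1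
  set k2 := ⌊t / τ'⌋₊ with hk2
  have hk21 : k2 ≤ k1 := Nat.floor_le_floor (div_le_div_of_nonneg_left ht hτ0 hττ)
  have hk1t : k1 * τ ≤ t := by
    rw [← le_div_iff₀ hτ0]; exact Nat.floor_le (by positivity)
  have hk2t : k2 * τ' ≤ t := by
    rw [← le_div_iff₀ hτ'0]; exact Nat.floor_le (by positivity)
  have hsub : blockMap n hn b ⁻¹' {x | Near π₁ π₂ U₁ U₂ t ω x} ⊆
      Set.pi (Finset.range k1 : Finset ℕ) (fun j => if j < k2 then {y j} else
        {i | ∀ k, π₁ (b i k) = π₁ (b (y j) k)}) := by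
    intro z hz
    have hyz : Near π₁ π₂ U₁ U₂ t (blockMap n hn b y) (blockMap n hn b z) :=
      (Near.equivalence h1 h2 t).trans ((Near.equivalence h1 h2 t).symm hy) hz
    have hbv : ∀ (y : ℕ → B) (j : ℕ) (k : Fin n), blockMap n hn b y (n * j + k) = b (y j) k := by
      intro y j k
      rw [blockMap_shift]
      simp [blockMap, Nat.div_eq_of_lt k.2, Nat.mod_eq_of_lt k.2]
    have hidx : ∀ j N (k : Fin n), j < N → n * j + k < n * N := by
      intro j N k hj
      calc n * j + k < n * j + n := by omega
        _ = n * (j + 1) := by ring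
        _ ≤ n * N := Nat.mul_le_mul_left _ hj
    have e1 : ∀ j < k1, ∀ k, π₁ (b (z j) k) = π₁ (b (y j) k) := by
      intro j hj k
      have := (hyz (n * j + k)).1 (by
        refine (h1.lt _ (hidx j k1 k hj)).trans_le ?_
        exact (block_U_le h1 n hn b τ (fun i x hx => (hτ i x hx).1) y k1).trans hk1t)
      rw [hbv, hbv] at this; exact this.symm
    have e2 : ∀ j < k2, ∀ k, π₂ (b (z j) k) = π₂ (b (y j) k) := by
      intro j hj k
      have := (hyz (n * j + k)).2 (by
        refine (h2.lt _ (hidx j k2 k hj)).trans_le ?_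
        exact (block_U_le h2 n hn b τ' (fun i x hx => (hτ i x hx).2) y k2).trans hk2t)
      rw [hbv, hbv] at this; exact this.symm
    intro j hj
    have hj1 : j < k1 := by simpa using hj
    beta_reduce
    split_ifs with h
    · rw [mem_singleton_iff]
      apply hb; ext k
      exact hinj (by simp [e1 j hj1 k, e2 j h k])
    · exact fun k => e1 j hj1 k
  refine (measure_mono hsub).trans ?_
  rw [Measure.infinitePi_pi _ (fun i _ => MeasurableSet.of_discrete)]
  have hbd : ∀ j ∈ Finset.range k1, P (if j < k2 then {y j} else {i | ∀ k, π₁ (b i k) = π₁ (b (y j) k)}) ≤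
      ENNReal.ofReal (if j < k2 then Real.exp (-α) else Real.exp (-β)) := by
    intro j _
    split_ifs with h
    · exact hα _
    · exact hβ _
  refine (Finset.prod_le_prod' hbd).trans ?_
  rw [← ENNReal.ofReal_prod_of_nonneg (fun i _ => by split_ifs <;> positivity)]
  refine ENNReal.ofReal_le_ofReal ?_
  have hprod : ∏ j ∈ Finset.range k1, (if j < k2 then Real.exp (-α) else Real.exp (-β)) =
      Real.exp (-(α * k2 + β * (k1 - k2))) := by
    rw [show k1 = k2 + (k1 - k2) by omega, Finset.prod_range_add]
    rw [Finset.prod_congr rfl (g := fun _ => Real.exp (-α)) (fun j hj => by simp [Finset.mem_range.1 hj])]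
    rw [Finset.prod_congr (s₁ := Finset.range (k1 - k2)) rfl (g := fun _ => Real.exp (-β)) (fun j hj => by simp)]
    simp only [Finset.prod_const, Finset.card_range]
    rw [← Real.exp_nat_mul, ← Real.exp_nat_mul, ← Real.exp_add]
    congr 1; push_cast; ring
  rw [hprod, ← Real.exp_add, Real.exp_le_exp]
  have f1 : |(k1:ℝ) - t / τ| ≤ 1 := by
    have := Nat.floor_le (show 0 ≤ t / τ by positivity)
    have := Nat.lt_floor_add_one (t / τ)
    rw [abs_le]; constructor <;> linarith
  have f2 : |(k2:ℝ) - t / τ'| ≤ 1 := by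
    have := Nat.floor_le (show 0 ≤ t / τ' by positivity)
    have := Nat.lt_floor_add_one (t / τ')
    rw [abs_le]; constructor <;> linarith
  have g1 : |β * (k1 - t / τ)| ≤ |β| := by
    rw [abs_mul]; exact mul_le_of_le_one_right (abs_nonneg _) f1
  have g2 : |(α - β) * (k2 - t / τ')| ≤ |α - β| := by
    rw [abs_mul]; exact mul_le_of_le_one_right (abs_nonneg _) f2
  have g3 : d * t ≤ ((α - β) / τ' + β / τ) * t := mul_le_mul_of_nonneg_right hdim ht
  have g4 : ((α - β) / τ' + β / τ) * t = (α - β) * (t / τ') + β * (t / τ) := by ring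
  have := (abs_le.1 g1).1
  have := (abs_le.1 g2).1
  nlinarith

theorem mass_distribution {X : Type*} [MetricSpace X] [MeasurableSpace X] [BorelSpace X] (ν : Measure X)
    (d M : ℝ) (hd : 0 < d) (hM : 0 < M)
    (h : ∀ t, 0 ≤ t → ∀ x, ν (closedBall x (Real.exp (-t))) ≤ ENNReal.ofReal (M * Real.exp (-(d * t))))
    (S : Set X) (hS : ν S ≠ 0) : ENNReal.ofReal d ≤ dimH S := by
  have key : (ENNReal.ofReal M)⁻¹ • ν ≤ μH[d] := by
    refine Measure.le_hausdorffMeasure d _ 1 one_pos fun s hs => ?_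
    rw [Measure.smul_apply, smul_eq_mul]
    have hM0 : ENNReal.ofReal M ≠ 0 := by simpa using hM
    have hMt : ENNReal.ofReal M ≠ ∞ := ENNReal.ofReal_ne_top
    rw [← ENNReal.div_eq_inv_mul, ENNReal.div_le_iff hM0 hMt]
    rcases s.eq_empty_or_nonempty with rfl | ⟨x, hx⟩
    · simp
    have hfin : ediam s ≠ ∞ := (hs.trans_lt ENNReal.one_lt_top).ne
    have hsub : ∀ t, diam s ≤ Real.exp (-t) → s ⊆ closedBall x (Real.exp (-t)) := by
      intro t ht y hy
      exact (dist_le_diam_of_mem' hfin hy hx).trans ht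
    have hdiam : ediam s = ENNReal.ofReal (diam s) := by
      rw [Metric.diam, ENNReal.ofReal_toReal hfin]
    rcases eq_or_lt_of_le (diam_nonneg (s := s)) with h0 | h0
    · have hz : ν s ≤ 0 := by
        have ht : Tendsto (fun t : ℝ => ENNReal.ofReal (M * Real.exp (-(d * t)))) atTop (nhds 0) := by
          rw [← ENNReal.ofReal_zero]
          refine ENNReal.tendsto_ofReal ?_
          have h1 : Tendsto (fun t : ℝ => Real.exp (-(d * t))) atTop (nhds 0) :=
            Real.tendsto_exp_neg_atTop_nhds_zero.comp (tendsto_id.const_mul_atTop hd)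
          simpa using h1.const_mul M
        refine ge_of_tendsto ht ?_
        filter_upwards [eventually_ge_atTop 0] with t ht
        exact (measure_mono (hsub t (by rw [← h0]; exact (Real.exp_pos _).le))).trans (h t ht x)
      exact hz.trans bot_le
    · have hle1 : diam s ≤ 1 := by
        have := ENNReal.toReal_mono ENNReal.one_ne_top hs
        simpa [Metric.diam] using this
      have hexp : Real.exp (-(-Real.log (diam s))) = diam s := by rw [neg_neg, Real.exp_log h0]
      have ht0 : 0 ≤ -Real.log (diam s) := by
        have := Real.log_nonpos h0.le hle1; linarith
      have h2 := (measure_mono (hsub (-Real.log (diam s)) hexp.ge)).trans (h _ ht0 x)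
      refine h2.trans ?_
      rw [hdiam, ENNReal.ofReal_rpow_of_pos h0, ← ENNReal.ofReal_mul (by positivity)]
      refine ENNReal.ofReal_le_ofReal ?_
      rw [Real.rpow_def_of_pos h0, mul_comm]
      refine mul_le_mul_of_nonneg_right (Real.exp_le_exp.2 ?_) hM.le
      linarith
  have hne : μH[(d.toNNReal : ℝ≥0)] S ≠ 0 := by
    rw [Real.coe_toNNReal d hd.le]
    intro h0
    have h1 := key S
    rw [h0, Measure.smul_apply, smul_eq_mul] at h1
    have h2 := mul_eq_zero.1 (le_antisymm h1 bot_le)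
    rcases h2 with h2 | h2
    · simp at h2
    · exact hS h2
  exact le_dimH_of_hausdorffMeasure_ne_zero hne


theorem D_fiber {X Y : Type*} [Fintype X] [DecidableEq Y] (μ : X → ℝ)
    (h : X → Y) (S : Finset Y) :
    ∑ y ∈ S, ∑ x with h x = y, μ x = ∑ x with h x ∈ S, μ x := by
  rw [← Finset.sum_fiberwise_of_maps_to (s := Finset.univ.filter fun x => h x ∈ S) (t := S) (g := h)
    (fun x hx => (Finset.mem_filter.1 hx).2)]
  refine Finset.sum_congr rfl fun y hy => Finset.sum_congr ?_ fun _ _ => rfl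
  ext x
  simp only [Finset.mem_filter, Finset.mem_univ, true_and]
  exact ⟨fun hx => ⟨hx ▸ hy, hx⟩, fun hx => hx.2⟩

theorem D_count {X A B : Type*} [Fintype X] [DecidableEq A] [DecidableEq B] (μ : X → ℝ)
    (hμ0 : ∀ x, 0 ≤ μ x) (hμ1 : ∑ x, μ x = 1) (f : X → A) (p : A → B) (E : Finset X) (a b : ℝ)
    (ha1 : ∀ x ∈ E, Real.exp (-a - 1) ≤ ∑ y with f y = f x, μ y)
    (ha2 : ∀ x ∈ E, ∑ y with f y = f x, μ y ≤ Real.exp (-a))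
    (hb1 : ∀ x ∈ E, Real.exp (-b - 1) ≤ ∑ y with p (f y) = p (f x), μ y)
    (hb2 : ∀ x ∈ E, ∑ y with p (f y) = p (f x), μ y ≤ Real.exp (-b)) :
    ((E.image (fun x => p (f x))).card : ℝ) ≤ Real.exp (b + 1) ∧
    (∀ v ∈ E.image (fun x => p (f x)), (((E.image f).filter fun w => p w = v).card : ℝ) ≤ Real.exp (a + 1 - b)) ∧
    (∑ x ∈ E, μ x) * Real.exp a ≤ (E.image f).card := by
  have gen : ∀ {Y : Type _} [DecidableEq Y] (h : X → Y) (S : Finset Y) (t u : ℝ) (Z : Finset X),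
      (∀ y ∈ S, Real.exp (-t) ≤ ∑ x with h x = y, μ x) → (∀ x, h x ∈ S → x ∈ Z) →
      ∑ x ∈ Z, μ x ≤ Real.exp (-u) → (S.card : ℝ) ≤ Real.exp (t - u) := by
    intro Y _ h S t u Z hS hZ hu
    have h1 : (S.card : ℝ) * Real.exp (-t) ≤ Real.exp (-u) := by
      refine le_trans ?_ hu
      refine le_trans ?_ (Finset.sum_le_sum_of_subset_of_nonneg
        (s := Finset.univ.filter fun x => h x ∈ S) (fun x hx => hZ x (Finset.mem_filter.1 hx).2) (fun x _ _ => hμ0 x))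
      rw [← D_fiber, ← nsmul_eq_mul]
      exact Finset.card_nsmul_le_sum _ _ _ hS
    rw [sub_eq_add_neg, add_comm, Real.exp_add]
    rw [Real.exp_neg t, ← div_eq_mul_inv, div_le_iff₀ (Real.exp_pos t)] at h1
    exact h1
  have gen' : ∀ (h : X → B) (S : Finset B) (t u : ℝ) (Z : Finset X),
      (∀ y ∈ S, Real.exp (-t) ≤ ∑ x with h x = y, μ x) → (∀ x, h x ∈ S → x ∈ Z) →
      ∑ x ∈ Z, μ x ≤ Real.exp (-u) → (S.card : ℝ) ≤ Real.exp (t - u) := by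
    intro h S t u Z hS hZ hu
    have h1 : (S.card : ℝ) * Real.exp (-t) ≤ Real.exp (-u) := by
      refine le_trans ?_ hu
      refine le_trans ?_ (Finset.sum_le_sum_of_subset_of_nonneg
        (s := Finset.univ.filter fun x => h x ∈ S) (fun x hx => hZ x (Finset.mem_filter.1 hx).2) (fun x _ _ => hμ0 x))
      rw [← D_fiber, ← nsmul_eq_mul]
      exact Finset.card_nsmul_le_sum _ _ _ hS
    rw [sub_eq_add_neg, add_comm, Real.exp_add]
    rw [Real.exp_neg t, ← div_eq_mul_inv, div_le_iff₀ (Real.exp_pos t)] at h1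
    exact h1
  refine ⟨?_, ?_, ?_⟩
  · have := gen' (fun x => p (f x)) (E.image (fun x => p (f x))) (b + 1) 0 Finset.univ (by
      intro y hy
      obtain ⟨x, hx, rfl⟩ := Finset.mem_image.1 hy
      rw [neg_add']
      exact hb1 x hx) (by simp) (by simp [hμ1])
    simpa using this
  · intro v hv
    obtain ⟨x, hx, rfl⟩ := Finset.mem_image.1 hv
    refine gen f ((E.image f).filter fun w => p w = p (f x)) (a + 1) b
      (Finset.univ.filter fun y => p (f y) = p (f x)) ?_ ?_ (hb2 x hx)
    · intro y hy
      obtain ⟨z, hz, rfl⟩ := Finset.mem_image.1 (Finset.mem_filter.1 hy).1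
      rw [neg_add']
      exact ha1 z hz
    · intro y hy
      simpa using (Finset.mem_filter.1 hy).2
  · have h1 : ∑ x ∈ E, μ x ≤ ((E.image f).card : ℝ) * Real.exp (-a) := by
      calc ∑ x ∈ E, μ x ≤ ∑ x with f x ∈ E.image f, μ x :=
            Finset.sum_le_sum_of_subset_of_nonneg (fun x hx => by
              simp only [Finset.mem_filter, Finset.mem_univ, true_and]
              exact Finset.mem_image_of_mem f hx) (fun x _ _ => hμ0 x)
        _ = ∑ w ∈ E.image f, ∑ x with f x = w, μ x := (D_fiber _ _ _).symm
        _ ≤ (E.image f).card • Real.exp (-a) := by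
            refine Finset.sum_le_card_nsmul _ _ _ fun w hw => ?_
            obtain ⟨z, hz, rfl⟩ := Finset.mem_image.1 hw
            exact ha2 z hz
        _ = _ := nsmul_eq_mul _ _
    rw [Real.exp_neg, ← div_eq_mul_inv, le_div_iff₀ (Real.exp_pos a)] at h1
    exact h1

theorem D_pigeon {X Y : Type*} [DecidableEq Y] (μ : X → ℝ) (G : Finset X) (h : X → Y)
    (t : Finset Y) (ht : ∀ x ∈ G, h x ∈ t) (hne : 0 < ∑ x ∈ G, μ x) :
    ∃ y ∈ t, ∑ x ∈ G, μ x ≤ t.card * ∑ x ∈ G with h x = y, μ x := by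
  by_contra hcon
  push Not at hcon
  have htn : t.Nonempty := by
    by_contra h0
    rw [Finset.not_nonempty_iff_eq_empty] at h0
    have : G = ∅ := Finset.eq_empty_of_forall_notMem fun x hx => by simpa [h0] using ht x hx
    simp [this] at hne
  have h1 := Finset.sum_lt_sum_of_nonempty htn hcon
  rw [← Finset.mul_sum, Finset.sum_fiberwise_of_maps_to ht, Finset.sum_const, nsmul_eq_mul] at h1
  exact lt_irrefl _ h1

/-- first time the weight reaches level `t` -/
def hit {Λ : Type*} (U : (ℕ → Λ) → ℕ → ℝ) (x : ℕ → Λ) (t : ℝ) : ℕ := sInf {n | t ≤ U x n}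

theorem hit_le {Λ : Type*} {U : (ℕ → Λ) → ℕ → ℝ} {x : ℕ → Λ} {t : ℝ} {n : ℕ} (h : t ≤ U x n) :
    hit U x t ≤ n := Nat.sInf_le h

theorem le_hit {Λ Γ : Type*} {π : Λ → Γ} {U : (ℕ → Λ) → ℕ → ℝ} {c C : ℝ} (h : Wt π U c C)
    (x : ℕ → Λ) (t : ℝ) : t ≤ U x (hit U x t) := by
  refine Nat.sInf_mem (s := {n | t ≤ U x n}) ?_
  obtain ⟨n, hn⟩ := exists_nat_ge (t / c)
  rw [div_le_iff₀ h.cpos] at hn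
  refine ⟨n, ?_⟩
  have := h.lower x n
  show t ≤ U x n
  linarith

theorem hit_upper {Λ Γ : Type*} {π : Λ → Γ} {U : (ℕ → Λ) → ℕ → ℝ} {c C : ℝ} (h : Wt π U c C)
    (x : ℕ → Λ) (t : ℝ) (ht : 0 ≤ t) : U x (hit U x t) ≤ t + 2 * C := by
  have hC : 0 < C := h.cpos.trans_le (h.cC x)
  rcases Nat.eq_zero_or_pos (hit U x t) with h0 | h0
  · rw [h0, h.zero]; positivity
  · obtain ⟨k, hk⟩ := Nat.exists_eq_succ_of_ne_zero h0.ne'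
    have h1 : U x k < t := by
      by_contra hh
      have := hit_le (not_lt.1 hh)
      omega
    have := h.succ_le x k
    rw [hk]; simp only [Nat.succ_eq_add_one]; linarith

theorem hit_mono {Λ Γ : Type*} {π : Λ → Γ} {U : (ℕ → Λ) → ℕ → ℝ} {c C : ℝ} (h : Wt π U c C)
    (x : ℕ → Λ) {t t' : ℝ} (htt : t ≤ t') : hit U x t ≤ hit U x t' :=
  hit_le (htt.trans (le_hit h x t'))

theorem D_chain {Λ Γ₁ Γ₂ : Type*} {π₁ : Λ → Γ₁} {π₂ : Λ → Γ₂} {U₁ U₂ : (ℕ → Λ) → ℕ → ℝ}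
    {c C : ℝ} (h1 : Wt π₁ U₁ c C) (h2 : Wt π₂ U₂ c C) (T P : ℕ) (hP : (T : ℝ) ≤ c * P) (x : ℕ → Λ)
    (hx : hit U₂ x T ≤ hit U₁ x T) :
    ∃ n τ : ℕ → ℕ, τ 0 = T ∧ (∀ m, τ m ≤ T) ∧ (∀ m, n m ≤ P) ∧ (∀ m, n (m + 1) ≤ n m) ∧
      (∀ m, τ (m + 1) ≤ τ m) ∧ (∀ m, (τ m : ℝ) ≤ U₁ x (n m)) ∧ (∀ m, U₁ x (n m) ≤ τ m + 2 * C + 1) ∧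
      (∀ m, (τ m : ℝ) ≤ U₂ x (n (m + 1))) ∧ (∀ m, U₂ x (n (m + 1)) ≤ τ m + 2 * C) ∧
      (∀ m, (c / (2 * C)) ^ m * T - m ≤ τ m) := by
  have hc := h1.cpos
  have hcC := h1.cC x
  have hC : 0 < C := hc.trans_le hcC
  let F : ℕ → ℕ × ℕ := fun m => Nat.rec (hit U₁ x T, T)
    (fun _ p => (hit U₂ x p.2, min ⌊U₁ x (hit U₂ x p.2)⌋₊ p.2)) m
  set n : ℕ → ℕ := fun m => (F m).1 with hn
  set τ : ℕ → ℕ := fun m => (F m).2 with hτ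
  have n0 : n 0 = hit U₁ x T := rfl
  have t0 : τ 0 = T := rfl
  have ns : ∀ m, n (m + 1) = hit U₂ x (τ m) := fun m => rfl
  have ts : ∀ m, τ (m + 1) = min ⌊U₁ x (n (m + 1))⌋₊ (τ m) := fun m => rfl
  have tmono : ∀ m, τ (m + 1) ≤ τ m := fun m => by rw [ts]; exact min_le_right _ _
  have nmono : ∀ m, n (m + 1) ≤ n m := by
    intro m
    cases m with
    | zero => rw [ns, t0, n0]; exact hx
    | succ m => rw [ns (m + 1), ns m]; exact hit_mono h2 x (by exact_mod_cast tmono m)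
  have hU0 : ∀ m, 0 ≤ U₁ x m := fun m => le_trans (by positivity) (h1.lower x m)
  have tT : ∀ m, τ m ≤ T := by
    intro m
    induction m with
    | zero => exact t0.le
    | succ m ih => exact (tmono m).trans ih
  have l1 : ∀ m, (τ m : ℝ) ≤ U₁ x (n m) := by
    intro m
    cases m with
    | zero => rw [t0, n0]; exact le_hit h1 x T
    | succ m =>
      refine le_trans ?_ (Nat.floor_le (hU0 _))
      exact_mod_cast (ts m).trans_le (min_le_left _ _)
  have l2 : ∀ m, (τ m : ℝ) ≤ U₂ x (n (m + 1)) := fun m => by rw [ns]; exact le_hit h2 x _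
  have u1 : ∀ m, U₁ x (n m) ≤ τ m + 2 * C + 1 := by
    intro m
    induction m with
    | zero =>
      have := hit_upper h1 x T (by positivity)
      rw [t0, n0]; linarith
    | succ m ih =>
      rcases le_total ⌊U₁ x (n (m + 1))⌋₊ (τ m) with hh | hh
      · rw [ts, min_eq_left hh]
        have := Nat.lt_floor_add_one (U₁ x (n (m + 1)))
        linarith
      · rw [ts, min_eq_right hh]
        exact (h1.mono x (nmono m)).trans ih
  have hρ0 : 0 < c / (2 * C) := by positivity
  have hρ1 : c / (2 * C) ≤ 1 := by rw [div_le_one (by positivity)]; linarith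
  refine ⟨n, τ, t0, tT, ?_, nmono, tmono, l1, u1, l2, fun m => ?_, ?_⟩
  · intro m
    induction m with
    | zero => rw [n0]; exact hit_le (hP.trans (h1.lower x P))
    | succ m ih => exact (nmono m).trans ih
  · rw [ns]; exact hit_upper h2 x _ (by positivity)
  · intro m
    induction m with
    | zero => simp [t0]
    | succ m ih =>
      have e1 : c / (2 * C) * τ m - 1 ≤ τ (m + 1) := by
        rcases le_total ⌊U₁ x (n (m + 1))⌋₊ (τ m) with hh | hh
        · rw [ts, min_eq_left hh]
          have a1 := Nat.lt_floor_add_one (U₁ x (n (m + 1)))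
          have a2 := h1.lower x (n (m + 1))
          have a3 := h2.upper x (n (m + 1))
          have a4 := l2 m
          have a5 : c / (2 * C) * τ m ≤ c / (2 * C) * (2 * C * n (m + 1)) :=
            mul_le_mul_of_nonneg_left (a4.trans a3) hρ0.le
          have a6 : c / (2 * C) * (2 * C * n (m + 1)) = c * n (m + 1) := by field_simp
          linarith
        · rw [ts, min_eq_right hh]
          have : c / (2 * C) * τ m ≤ 1 * τ m := mul_le_mul_of_nonneg_right hρ1 (by positivity)
          linarith
      have e2 : c / (2 * C) * ((c / (2 * C)) ^ m * T - m) ≤ c / (2 * C) * τ m :=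
        mul_le_mul_of_nonneg_left ih hρ0.le
      have e3 : c / (2 * C) * m ≤ 1 * m := mul_le_mul_of_nonneg_right hρ1 (by positivity)
      rw [pow_succ]; push_cast
      nlinarith


/-- Combinatorial output: a family of blocks of a common length with good entropy bounds. -/
def GoodBlocks {Λ Γ₁ : Type*} (π₁ : Λ → Γ₁) (U₁ U₂ : (ℕ → Λ) → ℕ → ℝ) (C d : ℝ) : Prop :=
  ∃ (n : ℕ) (W : Finset (Fin n → Λ)) (τ τ' α β : ℝ), 0 < n ∧ W.Nonempty ∧ 0 < τ ∧ τ ≤ τ' ∧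
    (∀ w ∈ W, ∀ x : ℕ → Λ, (∀ k : Fin n, x k = w k) → U₁ x n + C ≤ τ ∧ U₂ x n + C ≤ τ') ∧
    Real.exp α ≤ W.card ∧
    (∀ w ∈ W, ∀ S ⊆ W, (∀ v ∈ S, ∀ k, π₁ (v k) = π₁ (w k)) →
      (S.card : ℝ) ≤ Real.exp (-β) * W.card) ∧
    d ≤ (α - β) / τ' + β / τ

theorem D_floor (m R : ℝ) (N : ℕ) (hm : 0 < m) (hm1 : m ≤ 1) (hR : -R ≤ Real.log m) (hN : R ≤ N) :
    ⌊-Real.log m⌋₊ ≤ N ∧ Real.exp (-(⌊-Real.log m⌋₊ : ℝ) - 1) ≤ m ∧ m ≤ Real.exp (-(⌊-Real.log m⌋₊ : ℝ)) := by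
  have h0 : 0 ≤ -Real.log m := by have := Real.log_nonpos hm.le hm1; linarith
  have h1 := Nat.floor_le h0
  have h2 := Nat.lt_floor_add_one (-Real.log m)
  refine ⟨?_, ?_, ?_⟩
  · have : (⌊-Real.log m⌋₊ : ℝ) ≤ N := by linarith
    exact_mod_cast this
  · rw [← Real.le_log_iff_exp_le hm]; linarith
  · rw [← Real.log_le_iff_le_exp hm]; linarith

theorem D_iter (a b t : ℕ → ℝ) (M : ℕ) (s η θ C Q : ℝ) (hs : 0 ≤ s) (hη : 0 < η) (hC : 0 < C)
    (ht : ∀ m, 0 ≤ t m) (hb : 0 ≤ b M) (tmin : ∀ m ≤ M, Q ≤ t m)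
    (hTs : s * (3 * C + 1) + (θ + 2) ≤ η / 4 * Q)
    (hsq : ∀ m < M, s * t m ≤ b m + a (m + 1) - b (m + 1) + (θ + 2))
    (hfail : ∀ m < M, (a (m + 1) - b (m + 1) : ℝ) / (t m + (3 * C + 1)) +
      (b (m + 1) - (θ + 2)) / (t (m + 1) + (3 * C + 1)) < s - η)
    (hb0 : b 0 < t 0 * (M * (η / 2))) : False := by
  -- iterate
  have htpos : ∀ m, (0 : ℝ) < t m + (3 * C + 1) := fun m => by have := ht m; positivity
  have hit1 : ∀ m ≤ M, b m / (t m + (3 * C + 1)) ≤ b 0 / (t 0 + (3 * C + 1)) - m * (η / 2) := by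
    intro m
    induction m with
    | zero => intro _; simp
    | succ m ih =>
      intro hm
      have i1 := ih (by omega)
      have i2 := hfail m hm
      have i3 := hsq m hm
      have i4 := tmin m (by omega)
      have i5 := tmin (m + 1) hm
      set A := t m + (3 * C + 1) with hA
      set A' := t (m + 1) + (3 * C + 1) with hA'
      have hA0 : 0 < A := htpos m
      have hA0' : 0 < A' := htpos (m + 1)
      have hsC : 0 ≤ s * (3 * C + 1) := by positivity
      have j1 : (s * (3 * C + 1) + (θ + 2)) / A ≤ η / 4 := by
        rw [div_le_iff₀ hA0]
        refine hTs.trans (mul_le_mul_of_nonneg_left ?_ (by positivity))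
        rw [hA]; linarith
      have j2 : (θ + 2) / A' ≤ η / 4 := by
        rw [div_le_iff₀ hA0']
        refine le_trans ?_ ((hTs.trans (mul_le_mul_of_nonneg_left (c := A') ?_ (by positivity))))
        · linarith
        · rw [hA']; linarith
      have j3 : s - b m / A - (s * (3 * C + 1) + (θ + 2)) / A ≤ (a (m + 1) - b (m + 1)) / A := by
        rw [le_div_iff₀ hA0]
        have : (s - b m / A - (s * (3 * C + 1) + (θ + 2)) / A) * A = s * A - b m - (s * (3 * C + 1) + (θ + 2)) := by
          field_simp
        rw [this, hA]
        linarith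
      rw [sub_div (b (m + 1)) (θ + 2)] at i2
      push_cast
      linarith
  have hfin := hit1 M le_rfl
  have z1 : 0 ≤ b M / (t M + (3 * C + 1)) := div_nonneg hb (htpos M).le
  have z2 : b 0 / (t 0 + (3 * C + 1)) < M * (η / 2) := by
    rw [div_lt_iff₀ (htpos 0)]
    have : 0 ≤ (M : ℝ) * (η / 2) * (3 * C + 1) := by positivity
    linarith
  linarith

set_option maxHeartbeats 2000000 in
theorem D_regime {Λ Γ₁ Γ₂ X : Type*} [Fintype X] {π₁ : Λ → Γ₁} {π₂ : Λ → Γ₂}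
    {U₁ U₂ : (ℕ → Λ) → ℕ → ℝ}
    {c C : ℝ} (h1 : Wt π₁ U₁ c C) (h2 : Wt π₂ U₂ c C) (hC : 0 < C) (s η θ : ℝ) (hs : 0 ≤ s) (hη : 0 < η)
    (M T P R k0 : ℕ) (hP : (T : ℝ) ≤ c * P) (ext : X → ℕ → Λ)
    (hR : Real.log (2 * Fintype.card X) ≤ R)
    (hθ : (2 * (((P : ℝ) + 1) * ((T + 1) * ((R + 1) * (R + 1)))) ^ (M + 1)) ≤ Real.exp θ)
    (hT0 : (k0 : ℝ) ≤ (c / (2 * C)) ^ M * T - M) (hT1 : 1 ≤ (c / (2 * C)) ^ M * T - M)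
    (hTs : s * (3 * C + 1) + (θ + 2) ≤ η / 4 * ((c / (2 * C)) ^ M * T - M))
    (hRT : (R : ℝ) < T * (M * (η / 2)))
    (μ : X → ℝ) (hμ0 : ∀ x, 0 ≤ μ x) (hμ1 : ∑ x, μ x = 1)
    (hμ : ∀ k, k0 ≤ k → k ≤ T → ∀ S : Finset X,
      (∀ x ∈ S, ∀ y ∈ S, Near π₁ π₂ U₁ U₂ (k : ℝ) (ext x) (ext y)) → ∑ y ∈ S, μ y ≤ Real.exp (-(s * k)))
    (G : Finset X) (hG : ∀ x ∈ G, hit U₂ (ext x) T ≤ hit U₁ (ext x) T) (hGμ : 1 / 2 ≤ ∑ x ∈ G, μ x) :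
    GoodBlocks π₁ U₁ U₂ C (s - η) := by
  classical
  -- the chains
  have hch : ∀ x : X, ∃ n τ : ℕ → ℕ, x ∈ G → (τ 0 = T ∧ (∀ m, τ m ≤ T) ∧ (∀ m, n m ≤ P) ∧ (∀ m, n (m + 1) ≤ n m) ∧
      (∀ m, τ (m + 1) ≤ τ m) ∧ (∀ m, (τ m : ℝ) ≤ U₁ (ext x) (n m)) ∧ (∀ m, U₁ (ext x) (n m) ≤ τ m + 2 * C + 1) ∧
      (∀ m, (τ m : ℝ) ≤ U₂ (ext x) (n (m + 1))) ∧ (∀ m, U₂ (ext x) (n (m + 1)) ≤ τ m + 2 * C) ∧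
      (∀ m, (c / (2 * C)) ^ m * T - m ≤ τ m)) := by
    intro x
    by_cases hx : x ∈ G
    · obtain ⟨n, τ, h⟩ := D_chain h1 h2 T P hP (ext x) (hG x hx)
      exact ⟨n, τ, fun _ => h⟩
    · exact ⟨fun _ => 0, fun _ => 0, fun h => absurd h hx⟩
  choose n τ hnτ using hch
  -- the smoothed weights
  have hXne : Nonempty X := by
    by_contra hh
    rw [not_nonempty_iff] at hh
    simp at hμ1
  have hcard : (0 : ℝ) < Fintype.card X := by exact_mod_cast Fintype.card_pos
  set μ' : X → ℝ := fun x => (μ x + (Fintype.card X : ℝ)⁻¹) / 2 with hμ'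
  have hμ'0 : ∀ x, 0 ≤ μ' x := fun x => by have := hμ0 x; simp only [hμ']; positivity
  have hμ'1 : ∑ x, μ' x = 1 := by
    simp only [hμ']
    rw [← Finset.sum_div, Finset.sum_add_distrib, hμ1, Finset.sum_const, Finset.card_univ, nsmul_eq_mul,
      mul_inv_cancel₀ hcard.ne']
    norm_num
  have hμμ : ∀ S : Finset X, (∑ x ∈ S, μ x) / 2 ≤ ∑ x ∈ S, μ' x := by
    intro S
    rw [Finset.sum_div]
    refine Finset.sum_le_sum fun x _ => ?_
    have : 0 ≤ (Fintype.card X : ℝ)⁻¹ := by positivity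
    simp only [hμ']; linarith
  have hfl : ∀ {S : Finset X} (x : X), x ∈ S →
      ⌊-Real.log (∑ y ∈ S, μ' y)⌋₊ ≤ R ∧ Real.exp (-(⌊-Real.log (∑ y ∈ S, μ' y)⌋₊ : ℝ) - 1) ≤ (∑ y ∈ S, μ' y) ∧
        (∑ y ∈ S, μ' y) ≤ Real.exp (-(⌊-Real.log (∑ y ∈ S, μ' y)⌋₊ : ℝ)) := by
    intro S x hx
    have e1 : (2 * (Fintype.card X : ℝ))⁻¹ ≤ ∑ y ∈ S, μ' y := by
      refine le_trans ?_ (Finset.single_le_sum (fun y _ => hμ'0 y) hx)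
      have := hμ0 x
      simp only [hμ']
      rw [mul_inv]; linarith
    have e0 : (0 : ℝ) < (2 * (Fintype.card X : ℝ))⁻¹ := by positivity
    refine D_floor _ (Real.log (2 * Fintype.card X)) R (e0.trans_le e1) ?_ ?_ hR
    · rw [← hμ'1]
      exact Finset.sum_le_sum_of_subset_of_nonneg (Finset.subset_univ _) (fun y _ _ => hμ'0 y)
    · rw [← Real.log_inv]
      exact Real.log_le_log e0 e1
  -- prefixes
  let pre : (N : ℕ) → X → (Fin N → Λ) := fun N x k => ext x k
  let pr : (N : ℕ) → (Fin N → Λ) → (Fin N → Γ₁) := fun N w k => π₁ (w k)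
  let fa : ℕ → X → ℕ := fun N x => ⌊-Real.log (∑ y with pre N y = pre N x, μ' y)⌋₊
  let fb : ℕ → X → ℕ := fun N x => ⌊-Real.log (∑ y with pr N (pre N y) = pr N (pre N x), μ' y)⌋₊
  have hfa : ∀ N x, fa N x ≤ R ∧ Real.exp (-(fa N x : ℝ) - 1) ≤ (∑ y with pre N y = pre N x, μ' y) ∧
      (∑ y with pre N y = pre N x, μ' y) ≤ Real.exp (-(fa N x : ℝ)) := fun N x =>
    hfl (S := Finset.univ.filter fun y => pre N y = pre N x) x (Finset.mem_filter.2 ⟨Finset.mem_univ _, rfl⟩)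
  have hfb : ∀ N x, fb N x ≤ R ∧ Real.exp (-(fb N x : ℝ) - 1) ≤ (∑ y with pr N (pre N y) = pr N (pre N x), μ' y) ∧
      (∑ y with pr N (pre N y) = pr N (pre N x), μ' y) ≤ Real.exp (-(fb N x : ℝ)) := fun N x =>
    hfl (S := Finset.univ.filter fun y => pr N (pre N y) = pr N (pre N x)) x (Finset.mem_filter.2 ⟨Finset.mem_univ _, rfl⟩)
  clear_value fa fb
  -- pigeonhole
  let D : Finset (Fin (M + 1) → ℕ × ℕ × ℕ × ℕ) := Fintype.piFinset fun _ =>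
    Finset.range (P + 1) ×ˢ Finset.range (T + 1) ×ˢ Finset.range (R + 1) ×ˢ Finset.range (R + 1)
  let Φ : X → Fin (M + 1) → ℕ × ℕ × ℕ × ℕ := fun x m =>
    (n x m, τ x m, fa (n x m) x, fb (n x m) x)
  have hΦ : ∀ x ∈ G, Φ x ∈ D := by
    intro x hx
    obtain ⟨-, g2, g3, -⟩ := hnτ x hx
    simp only [D, Φ, Fintype.mem_piFinset, Finset.mem_product, Finset.mem_range, Nat.lt_succ_iff]
    intro m
    exact ⟨g3 _, g2 _, (hfa _ x).1, (hfb _ x).1⟩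
  obtain ⟨dat, -, hdat⟩ := D_pigeon μ G Φ D hΦ (by linarith)
  set E := G.filter fun x => Φ x = dat with hE
  have hDcard : (D.card : ℝ) = (((P : ℝ) + 1) * ((T + 1) * ((R + 1) * (R + 1)))) ^ (M + 1) := by
    simp [D, Fintype.card_piFinset, Finset.card_product]
  have hEμ : Real.exp (-θ) ≤ ∑ x ∈ E, μ x := by
    have hSnn : 0 ≤ ∑ x ∈ E, μ x := Finset.sum_nonneg fun x _ => hμ0 x
    have e1 : 1 ≤ Real.exp θ * ∑ x ∈ E, μ x := by
      calc (1 : ℝ) ≤ 2 * D.card * ∑ x ∈ E, μ x := by linarith only [hdat, hGμ]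
        _ ≤ _ := mul_le_mul_of_nonneg_right (by rw [hDcard]; exact hθ) hSnn
    rw [Real.exp_neg, inv_le_iff_one_le_mul₀ (Real.exp_pos θ)]
    linarith only [e1]
  have hEne : E.Nonempty := by
    by_contra h0
    rw [Finset.not_nonempty_iff_eq_empty] at h0
    rw [h0] at hEμ
    simp at hEμ
    exact absurd hEμ (not_le.2 (Real.exp_pos _))
  obtain ⟨x0, hx0⟩ := hEne
  have hEG : ∀ x ∈ E, x ∈ G := fun x hx => (Finset.mem_filter.1 hx).1
  have hEΦ : ∀ x ∈ E, Φ x = Φ x0 := fun x hx =>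
    ((Finset.mem_filter.1 hx).2).trans ((Finset.mem_filter.1 hx0).2).symm
  set N : ℕ → ℕ := n x0 with hN
  set t : ℕ → ℕ := τ x0 with ht
  set a : ℕ → ℕ := fun m => fa (N m) x0 with ha
  set b : ℕ → ℕ := fun m => fb (N m) x0 with hb
  have hEN : ∀ x ∈ E, ∀ m ≤ M, n x m = N m ∧ τ x m = t m ∧ fa (N m) x = a m ∧ fb (N m) x = b m := by
    intro x hx m hm
    have := congrFun (hEΦ x hx) ⟨m, Nat.lt_succ_of_le hm⟩
    simp only [Φ, Prod.mk.injEq] at this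
    obtain ⟨q1, q2, q3, q4⟩ := this
    rw [q1] at q3 q4
    exact ⟨q1, q2, q3, q4⟩
  obtain ⟨t0, tT, nP, nmono, tmono, l1, u1, l2, u2, tlow⟩ := hnτ x0 (hEG x0 hx0)
  have hcount : ∀ m ≤ M, _ := fun m hm => D_count μ' hμ'0 hμ'1 (pre (N m)) (pr (N m)) E (a m) (b m)
    (fun x hx => by rw [← (hEN x hx m hm).2.2.1]; exact (hfa _ x).2.1)
    (fun x hx => by rw [← (hEN x hx m hm).2.2.1]; exact (hfa _ x).2.2)
    (fun x hx => by rw [← (hEN x hx m hm).2.2.2]; exact (hfb _ x).2.1)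
    (fun x hx => by rw [← (hEN x hx m hm).2.2.2]; exact (hfb _ x).2.2)
  have hρ0 : 0 < c / (2 * C) := by have := h1.cpos; positivity
  have tanti : Antitone t := antitone_nat_of_succ_le tmono
  have tmin : ∀ m ≤ M, (c / (2 * C)) ^ M * T - M ≤ t m := by
    intro m hm
    refine (tlow M).trans ?_
    exact_mod_cast tanti hm
  have hsq : ∀ m < M, s * t m ≤ b m + a (m + 1) - b (m + 1) + (θ + 2) := by
    intro m hm
    let q : X → (Fin (N (m + 1)) → Λ) × (Fin (N m) → Γ₁) := fun x =>
      (pre (N (m + 1)) x, pr (N m) (pre (N m) x))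
    have e1 : ∑ x ∈ E, μ x ≤ ((E.image q).card : ℝ) * Real.exp (-(s * t m)) := by
      rw [← Finset.sum_fiberwise_of_maps_to (s := E) (t := E.image q) (g := q)
        (fun x hx => Finset.mem_image_of_mem q hx), ← nsmul_eq_mul]
      refine Finset.sum_le_card_nsmul _ _ _ fun v _ => ?_
      refine hμ (t m) ?_ (tT m) _ ?_
      · have := hT0.trans (tmin m hm.le)
        exact_mod_cast this
      · intro x hx y hy k
        obtain ⟨hxE, hxv⟩ := Finset.mem_filter.1 hx
        obtain ⟨hyE, hyv⟩ := Finset.mem_filter.1 hy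
        have hxy : q x = q y := hxv.trans hyv.symm
        obtain ⟨-, -, -, -, -, lx1, -, lx2, -⟩ := hnτ x (hEG x hxE)
        obtain ⟨r1, r2, -⟩ := hEN x hxE m hm.le
        obtain ⟨r3, -⟩ := hEN x hxE (m + 1) hm
        have lx1' := lx1 m
        have lx2' := lx2 m
        rw [r1, r2] at lx1'
        rw [r3, r2] at lx2'
        constructor
        · intro hk
          have hkN : k < N m := by
            by_contra hh
            have := h1.mono (ext x) (not_lt.1 hh)
            linarith only [this, hk, lx1']
          exact congrFun (congrArg Prod.snd hxy) ⟨k, hkN⟩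
        · intro hk
          have hkN : k < N (m + 1) := by
            by_contra hh
            have := h2.mono (ext x) (not_lt.1 hh)
            linarith only [this, hk, lx2']
          exact congrArg π₂ (congrFun (congrArg Prod.fst hxy) ⟨k, hkN⟩)
    have e2 : ((E.image q).card : ℝ) ≤ Real.exp (a (m + 1) + 1 - b (m + 1)) * Real.exp (b m + 1) := by
      have f0 : ((E.image q).image Prod.snd).card ≤ (E.image (fun x => pr (N m) (pre (N m) x))).card := by
        rw [Finset.image_image]; rfl
      have f1 : (E.image q).card ≤ ⌊Real.exp (a (m + 1) + 1 - b (m + 1))⌋₊ * ((E.image q).image Prod.snd).card := by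
        refine Finset.card_le_mul_card_image _ _ fun v hv => ?_
        obtain ⟨v', hv', rfl⟩ := Finset.mem_image.1 hv
        obtain ⟨x, hx, rfl⟩ := Finset.mem_image.1 hv'
        refine Nat.le_floor ?_
        refine le_trans ?_ ((hcount (m + 1) hm).2.1 (pr (N (m + 1)) (pre (N (m + 1)) x))
          (Finset.mem_image_of_mem (fun x => pr (N (m + 1)) (pre (N (m + 1)) x)) hx))
        norm_cast
        refine Finset.card_le_card_of_injOn Prod.fst ?_ ?_
        · intro w hw
          obtain ⟨hw1, hw2⟩ := Finset.mem_filter.1 hw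
          obtain ⟨y, hy, rfl⟩ := Finset.mem_image.1 hw1
          refine Finset.mem_coe.2 (Finset.mem_filter.2 ⟨Finset.mem_image_of_mem _ hy, ?_⟩)
          funext k
          exact congrFun hw2 ⟨k, k.2.trans_le (nmono m)⟩
        · intro w hw w' hw' hww
          obtain ⟨hw1, hw2⟩ := Finset.mem_filter.1 hw
          obtain ⟨hw1', hw2'⟩ := Finset.mem_filter.1 hw'
          exact Prod.ext hww (hw2.trans hw2'.symm)
      calc ((E.image q).card : ℝ) ≤ (⌊Real.exp (a (m + 1) + 1 - b (m + 1))⌋₊ : ℝ) *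
            (((E.image q).image Prod.snd).card : ℝ) := by exact_mod_cast f1
        _ ≤ _ := by
          refine mul_le_mul (Nat.floor_le (Real.exp_pos _).le) ?_ (by positivity) (Real.exp_pos _).le
          refine le_trans ?_ (hcount m hm.le).1
          exact_mod_cast f0
    have e3 : Real.exp (-θ) ≤ Real.exp (a (m + 1) + 1 - b (m + 1)) * Real.exp (b m + 1) * Real.exp (-(s * t m)) :=
      (hEμ.trans e1).trans (mul_le_mul_of_nonneg_right e2 (Real.exp_pos _).le)
    rw [← Real.exp_add, ← Real.exp_add, Real.exp_le_exp] at e3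
    linarith only [e3]
  by_contra hcon
  have hfail : ∀ m < M, (a (m + 1) - b (m + 1) : ℝ) / (t m + (3 * C + 1)) +
      (b (m + 1) - (θ + 2)) / (t (m + 1) + (3 * C + 1)) < s - η := by
    intro m hm
    by_contra hge
    rw [not_lt] at hge
    have hlow : Real.exp (a (m + 1) - (θ + 1)) ≤ ((E.image (pre (N (m + 1)))).card : ℝ) := by
      refine le_trans ?_ (hcount (m + 1) hm).2.2
      have q1 : Real.exp (-(θ + 1)) ≤ ∑ x ∈ E, μ' x := by
        refine le_trans ?_ (hμμ E)
        have q2 : Real.exp (-1) ≤ 1 / 2 := by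
          rw [Real.exp_neg, ← one_div]
          refine one_div_le_one_div_of_le (by norm_num) ?_
          have := Real.add_one_le_exp (1 : ℝ); linarith only [this]
        rw [neg_add, Real.exp_add]
        have := mul_le_mul hEμ q2 (Real.exp_pos _).le (Finset.sum_nonneg fun x _ => hμ0 x)
        linarith only [this]
      rw [sub_eq_add_neg, add_comm, Real.exp_add]
      exact mul_le_mul_of_nonneg_right q1 (Real.exp_pos _).le
    refine hcon ⟨N (m + 1), E.image (pre (N (m + 1))), t (m + 1) + (3 * C + 1), t m + (3 * C + 1),
      a (m + 1) - (θ + 2), b (m + 1) - (θ + 2), ?_, ⟨_, Finset.mem_image_of_mem _ hx0⟩, by positivity, ?_, ?_, ?_, ?_, ?_⟩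
    · have p1 : (t (m + 1) : ℝ) ≤ U₁ (ext x0) (N (m + 1)) := l1 (m + 1)
      have p2 := hT1.trans (tmin (m + 1) hm)
      by_contra h0
      rw [show N (m + 1) = 0 by omega, h1.zero] at p1
      linarith only [p1, p2]
    · have : (t (m + 1) : ℝ) ≤ t m := by exact_mod_cast tmono m
      linarith only [this]
    · intro w hw x hx
      obtain ⟨y, hy, rfl⟩ := Finset.mem_image.1 hw
      have hxy : ∀ k < N (m + 1), x k = ext y k := fun k hk => hx ⟨k, hk⟩
      rw [h1.congr x (ext y) _ (fun k hk => by rw [hxy k hk]), h2.congr x (ext y) _ (fun k hk => by rw [hxy k hk])]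
      obtain ⟨-, -, -, -, -, -, ux1, -, ux2, -⟩ := hnτ y (hEG y hy)
      obtain ⟨r1, r2, -⟩ := hEN y hy m hm.le
      obtain ⟨r3, r4, -⟩ := hEN y hy (m + 1) hm
      have ux1' := ux1 (m + 1)
      have ux2' := ux2 m
      rw [r3, r4] at ux1'
      rw [r3, r2] at ux2'
      constructor <;> linarith only [ux1', ux2', hC]
    · refine le_trans (Real.exp_le_exp.2 ?_) hlow
      linarith only []
    · intro w hw S hSW hS
      obtain ⟨y, hy, rfl⟩ := Finset.mem_image.1 hw
      have q3 := (hcount (m + 1) hm).2.1 (pr (N (m + 1)) (pre (N (m + 1)) y))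
        (Finset.mem_image_of_mem (fun x => pr (N (m + 1)) (pre (N (m + 1)) x)) hy)
      have q4 : (S.card : ℝ) ≤ Real.exp (a (m + 1) + 1 - b (m + 1)) := by
        refine le_trans ?_ q3
        norm_cast
        refine Finset.card_le_card fun v hv => Finset.mem_filter.2 ⟨hSW hv, ?_⟩
        funext k
        exact hS v hv k
      refine q4.trans ?_
      refine le_trans ?_ (mul_le_mul_of_nonneg_left hlow (Real.exp_pos _).le)
      rw [← Real.exp_add, Real.exp_le_exp]
      linarith only []
    · rw [sub_sub_sub_cancel_right]
      exact hge
  have hb0 : b 0 ≤ R := (hfb _ x0).1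
  refine D_iter (fun m => a m) (fun m => b m) (fun m => t m) M s η θ C _ hs hη hC (fun m => Nat.cast_nonneg _)
    (Nat.cast_nonneg _) tmin hTs hsq hfail ?_
  rw [show t 0 = T from t0]
  refine lt_of_le_of_lt ?_ hRT
  exact_mod_cast hb0


theorem D_params (c C s η L : ℝ) (k0 : ℕ) (hc : 0 < c) (hC : 0 < C) (hη : 0 < η) (hL : 0 ≤ L) :
    ∃ (M T P R : ℕ) (θ : ℝ), k0 ≤ T ∧ (T : ℝ) ≤ c * P ∧ Real.log 2 + P * L ≤ R ∧
    (2 * (((P : ℝ) + 1) * ((T + 1) * ((R + 1) * (R + 1)))) ^ (M + 1)) ≤ Real.exp θ ∧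
    (k0 : ℝ) ≤ (c / (2 * C)) ^ M * T - M ∧ 1 ≤ (c / (2 * C)) ^ M * T - M ∧
    s * (3 * C + 1) + (θ + 2) ≤ η / 4 * ((c / (2 * C)) ^ M * T - M) ∧
    (R : ℝ) < T * (M * (η / 2)) := by
  set D : ℝ := 2 + (1 / c + 1) * L with hD
  obtain ⟨M, hM⟩ := exists_nat_gt (2 * D / η)
  set ρ := (c / (2 * C)) ^ M with hρ
  have hρ0 : 0 < ρ := by positivity
  have hc1 : 0 < 1 / c := by positivity
  have hD0 : 0 < D := by positivity
  set K := D + 1 / c + 3 with hK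
  have hK0 : 0 < K := by positivity
  set c0 : ℝ := s * (3 * C + 1) + 2 + Real.log 2 + 4 * (M + 1) * Real.log K + η * M / 4
  have hlin : ∀ a : ℝ, ∀ δ : ℝ, 0 < δ → ∀ᶠ T : ℕ in atTop, a ≤ δ * T := by
    intro a δ hδ
    exact (tendsto_natCast_atTop_atTop.const_mul_atTop hδ).eventually_ge_atTop a
  have hlog : ∀ δ : ℝ, 0 < δ → ∀ᶠ T : ℕ in atTop, Real.log T ≤ δ * T := by
    intro δ hδ
    have h1 := (Real.isLittleO_log_id_atTop.def hδ)
    filter_upwards [tendsto_natCast_atTop_atTop.eventually h1] with T hT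
    simp only [id, Real.norm_eq_abs, Nat.abs_cast] at hT
    exact (le_abs_self _).trans hT
  obtain ⟨T, g1, g2, g3, g4, g5, g6⟩ := ((hlin (k0 + M) ρ hρ0).and ((hlin (1 + M) ρ hρ0).and
    ((hlin c0 (η * ρ / 8) (by positivity)).and ((hlog (η * ρ / (32 * (M + 1))) (by positivity)).and
    ((eventually_ge_atTop 1).and (eventually_ge_atTop k0)))))).exists
  have hT1 : (1 : ℝ) ≤ T := by exact_mod_cast g5
  have hP1 := Nat.le_ceil ((T : ℝ) / c)
  have hP2 := (Nat.ceil_lt_add_one (a := (T : ℝ) / c) (by positivity)).le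
  set P := ⌈(T : ℝ) / c⌉₊
  have hl2 : Real.log 2 ≤ 1 := by
    have := Real.log_two_lt_d9; linarith
  have hl20 : 0 ≤ Real.log 2 := Real.log_nonneg (by norm_num)
  have hR1 := Nat.le_ceil (Real.log 2 + P * L)
  have hR2 := (Nat.ceil_lt_add_one (a := Real.log 2 + P * L) (by positivity)).le
  set R := ⌈Real.log 2 + P * L⌉₊
  have hPT : (P : ℝ) ≤ (1 / c + 1) * T := by
    have : (T : ℝ) / c = 1 / c * T := by ring
    rw [this] at hP2; linarith
  have hRT : (R : ℝ) ≤ D * T := by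
    have := mul_le_mul_of_nonneg_right hPT hL
    rw [hD]; nlinarith only [this, hR2, hl2, hT1]
  have a1 : (P : ℝ) + 1 ≤ K * T := by
    have : 0 ≤ D * T := by positivity
    rw [hK]; nlinarith only [this, hPT, hT1]
  have a2 : (T : ℝ) + 1 ≤ K * T := by
    have : 0 ≤ D * T := by positivity
    have : 0 ≤ 1 / c * T := by positivity
    rw [hK]; linarith
  have a3 : (R : ℝ) + 1 ≤ K * T := by
    have : 0 ≤ 1 / c * T := by positivity
    rw [hK]; linarith
  refine ⟨M, T, P, R, Real.log 2 + 4 * (M + 1) * (Real.log K + Real.log T), g6, ?_, hR1, ?_, ?_, ?_, ?_, ?_⟩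
  · rwa [div_le_iff₀' hc] at hP1
  · have hKT : 0 < K * T := by positivity
    rw [← Real.log_mul hK0.ne' (by positivity), Real.exp_add, Real.exp_log (by norm_num)]
    have e1 : Real.exp (4 * (M + 1) * Real.log (K * T)) = (K * T * (K * T * ((K * T) * (K * T)))) ^ (M + 1) := by
      rw [show (4 * ((M : ℝ) + 1) * Real.log (K * T)) = ((4 * (M + 1) : ℕ) : ℝ) * Real.log (K * T) by push_cast; ring,
        Real.exp_nat_mul, Real.exp_log hKT, pow_mul]
      ring
    rw [e1]
    gcongr
  · linarith
  · linarith
  · have e2 : 4 * ((M : ℝ) + 1) * Real.log T ≤ η * ρ / 8 * T := by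
      have := mul_le_mul_of_nonneg_left g4 (show (0 : ℝ) ≤ 4 * (M + 1) by positivity)
      refine this.trans (le_of_eq ?_)
      field_simp
      ring
    have e3 : c0 = s * (3 * C + 1) + 2 + Real.log 2 + 4 * (M + 1) * Real.log K + η * M / 4 := rfl
    nlinarith only [e2, e3, g3]
  · rw [div_lt_iff₀ hη] at hM
    nlinarith only [hM, hRT, hT1]

theorem D_main {Λ Γ₁ Γ₂ : Type*} [Fintype Λ] [Nonempty Λ] {π₁ : Λ → Γ₁} {π₂ : Λ → Γ₂}
    {U₁ U₂ : (ℕ → Λ) → ℕ → ℝ}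
    {c C : ℝ} (h1 : Wt π₁ U₁ c C) (h2 : Wt π₂ U₂ c C) (s η : ℝ) (hs : 0 ≤ s) (hη : 0 < η) (k0 : ℕ)
    (hcov : ∀ ι : Finset ((ℕ → Λ) × ℕ), (∀ p ∈ ι, k0 ≤ p.2) →
      (∀ x, ∃ p ∈ ι, Near π₁ π₂ U₁ U₂ (p.2 : ℝ) p.1 x) → 1 ≤ ∑ p ∈ ι, Real.exp (-(s * p.2))) :
    GoodBlocks π₁ U₁ U₂ C (s - η) ∨ GoodBlocks π₂ U₂ U₁ C (s - η) := by
  classical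
  obtain ⟨a0⟩ := ‹Nonempty Λ›
  have hcC := h1.cC (fun _ => a0)
  have hC : 0 < C := h1.cpos.trans_le hcC
  have hcard : (1 : ℝ) ≤ Fintype.card Λ := by
    exact_mod_cast Nat.succ_le_of_lt (Fintype.card_pos_iff.2 ⟨a0⟩)
  obtain ⟨M, T, P, R, θ, hk0T, hP, hR, hθ, hT0, hT1, hTs, hRT⟩ :=
    D_params c C s η (Real.log (Fintype.card Λ)) k0 h1.cpos hC hη (Real.log_nonneg hcard)
  let X := Fin P → Λ
  let ext : X → ℕ → Λ := fun x k => if h : k < P then x ⟨k, h⟩ else a0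
  have hequiv := Near.equivalence h1 h2
  obtain ⟨μ, hμ0, hμ1, hμ⟩ := fro_finite (X := X) (fun k x y => Near π₁ π₂ U₁ U₂ (k : ℝ) (ext x) (ext y))
    (fun k => ⟨fun x => (hequiv k).refl _, fun h => (hequiv k).symm h, fun h h' => (hequiv k).trans h h'⟩)
    (fun j k hjk x y h => Near.mono (by exact_mod_cast hjk) h) k0 T hk0T
    (fun k => Real.exp (-(s * k))) (fun k => Real.exp_pos _) (by
      intro ι hι hc
      have h3 := hcov (ι.image fun p => (ext p.1, p.2)) (by
        intro p hp
        obtain ⟨q, hq, rfl⟩ := Finset.mem_image.1 hp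
        exact (hι q hq).1) (by
        intro x
        obtain ⟨p, hp, hn⟩ := hc (fun k => x k)
        refine ⟨_, Finset.mem_image_of_mem _ hp, ?_⟩
        refine (hequiv _).trans hn ?_
        have hpT : (p.2 : ℝ) ≤ T := by exact_mod_cast (hι p hp).2
        have key : ∀ n : ℕ, c * n < (p.2 : ℝ) → n < P := by
          intro n hn
          have : c * n < c * P := by linarith
          have := lt_of_mul_lt_mul_left this h1.cpos.le
          exact_mod_cast this
        intro n
        refine ⟨fun hl => ?_, fun hl => ?_⟩
        · have := key n ((h1.lower _ n).trans_lt hl)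
          simp [ext, this]
        · have := key n ((h2.lower _ n).trans_lt hl)
          simp [ext, this])
      refine h3.trans ?_
      rw [Finset.sum_image]
      intro p _ q _ hpq
      simp only [Prod.mk.injEq] at hpq
      refine Prod.ext ?_ hpq.2
      funext k
      have := congrFun hpq.1 k
      simpa [ext] using this)
  have hRX : Real.log (2 * Fintype.card X) ≤ R := by
    refine le_trans (le_of_eq ?_) hR
    have : (Fintype.card X : ℝ) = (Fintype.card Λ : ℝ) ^ P := by simp [X]
    rw [this, Real.log_mul (by norm_num) (by positivity), Real.log_pow]
  set G : Finset X := Finset.univ.filter fun x => hit U₂ (ext x) T ≤ hit U₁ (ext x) T with hG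
  set G' : Finset X := Finset.univ.filter fun x => ¬ hit U₂ (ext x) T ≤ hit U₁ (ext x) T with hG'
  have hsum : ∑ x ∈ G, μ x + ∑ x ∈ G', μ x = 1 := by
    rw [← hμ1]; exact Finset.sum_filter_add_sum_filter_not _ _ _
  rcases le_or_gt (1 / 2) (∑ x ∈ G, μ x) with hh | hh
  · left
    exact D_regime h1 h2 hC s η θ hs hη M T P R k0 hP ext hRX hθ hT0 hT1 hTs hRT μ hμ0 hμ1 hμ G
      (fun x hx => (Finset.mem_filter.1 hx).2) hh
  · right
    exact D_regime h2 h1 hC s η θ hs hη M T P R k0 hP ext hRX hθ hT0 hT1 hTs hRT μ hμ0 hμ1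
      (fun k hk hk' S hS => hμ k hk hk' S (fun x hx y hy => Near.swap.1 (hS x hx y hy))) G'
      (fun x hx => (not_le.1 (Finset.mem_filter.1 hx).2).le) (by linarith)


theorem F_meas {Λ Γ₁ Γ₂ : Type*} {π₁ : Λ → Γ₁} {π₂ : Λ → Γ₂} {U₁ U₂ : (ℕ → Λ) → ℕ → ℝ}
    {c C : ℝ} (h1 : Wt π₁ U₁ c C) (h2 : Wt π₂ U₂ c C)
    (hinj : Function.Injective fun a => (π₁ a, π₂ a))
    [MetricSpace (ℕ → Λ)] (hd : ∀ t (x y : ℕ → Λ), dist x y ≤ Real.exp (-t) ↔ Near π₁ π₂ U₁ U₂ t x y)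
    [MeasurableSpace (ℕ → Λ)] [BorelSpace (ℕ → Λ)] :
    Measurable (fun (ω : ℕ → Λ) k => ω (k + 1)) :=
  (seq_continuous h1 h2 hd _ fun x k => seq_eventually_coord hinj hd x (k + 1)).measurable

theorem F_block {Λ Γ₁ Γ₂ B : Type*} {π₁ : Λ → Γ₁} {π₂ : Λ → Γ₂} {U₁ U₂ : (ℕ → Λ) → ℕ → ℝ}
    {c C : ℝ} (h1 : Wt π₁ U₁ c C) (h2 : Wt π₂ U₂ c C)
    [MetricSpace (ℕ → Λ)] (hd : ∀ t (x y : ℕ → Λ), dist x y ≤ Real.exp (-t) ↔ Near π₁ π₂ U₁ U₂ t x y)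
    [MeasurableSpace (ℕ → Λ)] [BorelSpace (ℕ → Λ)] [Countable B] [MeasurableSpace B]
    [DiscreteMeasurableSpace B] (n : ℕ) (hn : 0 < n) (b : B → Fin n → Λ) :
    Measurable (blockMap n hn b) := by
  let _ : TopologicalSpace B := ⊥
  have : DiscreteTopology B := ⟨rfl⟩
  refine (seq_continuous h1 h2 hd _ fun x k => ?_).measurable
  have : ∀ᶠ y in nhds x, y (k / n) = x (k / n) :=
    ((continuous_apply (k / n)).tendsto x).eventually (p := fun z => z = x (k / n))
      (by simp [nhds_discrete])
  filter_upwards [this] with y hy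
  simp only [blockMap, hy]

theorem F_any {Λ Γ₁ Γ₂ : Type*} [Nonempty Λ] {π₁ : Λ → Γ₁} {π₂ : Λ → Γ₂} {U₁ U₂ : (ℕ → Λ) → ℕ → ℝ}
    {c C : ℝ} (h1 : Wt π₁ U₁ c C) (h2 : Wt π₂ U₂ c C)
    (hinj : Function.Injective fun a => (π₁ a, π₂ a))
    [MetricSpace (ℕ → Λ)] (hd : ∀ t (x y : ℕ → Λ), dist x y ≤ Real.exp (-t) ↔ Near π₁ π₂ U₁ U₂ t x y)
    [MeasurableSpace (ℕ → Λ)] [BorelSpace (ℕ → Λ)] :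
    ∃ ν : Measure (ℕ → Λ), IsProbabilityMeasure ν ∧ Ergodic (fun ω k => ω (k + 1)) ν := by
  obtain ⟨a0⟩ := ‹Nonempty Λ›
  obtain ⟨ν, hν, he, -⟩ := block_ergodic (B := Unit) (Measure.dirac ()) 1 one_pos (fun _ _ => a0)
    (F_meas h1 h2 hinj hd) (F_block h1 h2 hd _ _ _)
  exact ⟨ν, hν, he⟩

theorem F_build {Λ Γ₁ Γ₂ : Type*} {π₁ : Λ → Γ₁} {π₂ : Λ → Γ₂} {U₁ U₂ : (ℕ → Λ) → ℕ → ℝ}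
    {c C : ℝ} (h1 : Wt π₁ U₁ c C) (h2 : Wt π₂ U₂ c C)
    (hinj : Function.Injective fun a => (π₁ a, π₂ a))
    [MetricSpace (ℕ → Λ)] (hd : ∀ t (x y : ℕ → Λ), dist x y ≤ Real.exp (-t) ↔ Near π₁ π₂ U₁ U₂ t x y)
    [MeasurableSpace (ℕ → Λ)] [BorelSpace (ℕ → Λ)] (d : ℝ) (hd0 : 0 < d)
    (hgood : GoodBlocks π₁ U₁ U₂ C d) :
    ∃ ν : Measure (ℕ → Λ), IsProbabilityMeasure ν ∧ Ergodic (fun ω k => ω (k + 1)) ν ∧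
      ENNReal.ofReal d ≤ dimHMeasure ν := by
  classical
  obtain ⟨n, W, τ, τ', α, β, hn, hW, hτ0, hττ, hτ, hα, hβ, hdim⟩ := hgood
  let B := {w // w ∈ W}
  let _ : MeasurableSpace B := ⊤
  have : DiscreteMeasurableSpace B := ⟨fun _ => trivial⟩
  have hcard : (0 : ℝ) < W.card := by exact_mod_cast hW.card_pos
  let P : Measure B := (W.card : ℝ≥0∞)⁻¹ • Measure.count
  have hPS : ∀ S : Finset B, P S = ENNReal.ofReal (S.card / W.card) := by
    intro S
    simp only [P, Measure.smul_apply, smul_eq_mul, Measure.count_apply_finset]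
    rw [ENNReal.ofReal_div_of_pos hcard, ENNReal.ofReal_natCast, ENNReal.ofReal_natCast,
      ENNReal.div_eq_inv_mul]
  have : IsProbabilityMeasure P := ⟨by
    have := hPS Finset.univ
    rw [Finset.coe_univ] at this
    rw [this]
    simp only [B, Finset.card_univ, Fintype.card_coe]
    rw [div_self hcard.ne', ENNReal.ofReal_one]⟩
  let b : B → Fin n → Λ := fun w => w.1
  have hΦ : Measurable (blockMap n hn b) := F_block h1 h2 hd n hn b
  obtain ⟨ν, hν, he, hac⟩ := block_ergodic P n hn b (F_meas h1 h2 hinj hd) hΦ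
  refine ⟨ν, hν, he, ?_⟩
  refine le_sInf ?_
  rintro _ ⟨S, hS, hS1, rfl⟩
  set ν0 := (Measure.infinitePi (fun _ : ℕ => P)).map (blockMap n hn b) with hν0
  have : IsProbabilityMeasure ν0 := Measure.isProbabilityMeasure_map hΦ.aemeasurable
  have hz : ν0 Sᶜ = 0 := hac _ hS.compl ((prob_compl_eq_zero_iff hS).2 hS1)
  have hS0 : ν0 S ≠ 0 := by
    rw [(prob_compl_eq_zero_iff hS).1 hz]; exact one_ne_zero
  refine mass_distribution ν0 d (Real.exp (|α - β| + |β|)) hd0 (Real.exp_pos _) ?_ S hS0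
  intro t ht x
  have hball : closedBall x (Real.exp (-t)) = {y | Near π₁ π₂ U₁ U₂ t x y} := by
    ext y
    rw [mem_closedBall, dist_comm, hd]; rfl
  rw [hν0, Measure.map_apply hΦ isClosed_closedBall.measurableSet, hball]
  refine block_ball h1 h2 hinj P n hn b Subtype.val_injective τ τ' α β d hτ0 hττ
    (fun i y hy => hτ i.1 i.2 y hy) ?_ ?_ hdim t ht x
  · intro i
    have := hPS {i}
    rw [Finset.coe_singleton] at this
    rw [this, Finset.card_singleton, Nat.cast_one, one_div, Real.exp_neg]
    exact ENNReal.ofReal_le_ofReal (inv_anti₀ (Real.exp_pos _) hα)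
  · intro i
    have h3 := hPS (Finset.univ.filter fun j => ∀ k, π₁ (b j k) = π₁ (b i k))
    have h4 : ((Finset.univ.filter fun j => ∀ k, π₁ (b j k) = π₁ (b i k) : Finset B) : Set B) =
      {j | ∀ k, π₁ (b j k) = π₁ (b i k)} := by simp
    rw [h4] at h3
    rw [h3]
    refine ENNReal.ofReal_le_ofReal ?_
    rw [div_le_iff₀ hcard]
    have h5 := hβ i.1 i.2 ((Finset.univ.filter fun j : B => ∀ k, π₁ (b j k) = π₁ (b i k)).map
      (Function.Embedding.subtype _)) (by
        intro v hv
        obtain ⟨j, -, rfl⟩ := Finset.mem_map.1 hv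
        exact j.2) (by
        intro v hv
        obtain ⟨j, hj, rfl⟩ := Finset.mem_map.1 hv
        exact (Finset.mem_filter.1 hj).2)
    rwa [Finset.card_map] at h5

theorem F_cov {Λ Γ₁ Γ₂ : Type*} {π₁ : Λ → Γ₁} {π₂ : Λ → Γ₂} {U₁ U₂ : (ℕ → Λ) → ℕ → ℝ}
    {c C : ℝ} (h1 : Wt π₁ U₁ c C) (h2 : Wt π₂ U₂ c C)
    [MetricSpace (ℕ → Λ)] (hd : ∀ t (x y : ℕ → Λ), dist x y ≤ Real.exp (-t) ↔ Near π₁ π₂ U₁ U₂ t x y)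
    [MeasurableSpace (ℕ → Λ)] [BorelSpace (ℕ → Λ)] (s K : ℝ) (hs : 0 ≤ s)
    (hcov : ∀ k0 : ℕ, ∃ ι : Finset ((ℕ → Λ) × ℕ), (∀ p ∈ ι, k0 ≤ p.2) ∧
      (∀ x, ∃ p ∈ ι, Near π₁ π₂ U₁ U₂ (p.2 : ℝ) p.1 x) ∧ ∑ p ∈ ι, Real.exp (-(s * p.2)) ≤ K) :
    Measure.hausdorffMeasure s (univ : Set (ℕ → Λ)) ≤ ENNReal.ofReal K := by
  choose ι hι1 hι2 hι3 using hcov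
  have hdiam : ∀ (k : ℕ) (x : ℕ → Λ), ediam {y | Near π₁ π₂ U₁ U₂ (k : ℝ) x y} ≤
      ENNReal.ofReal (Real.exp (-(k : ℝ))) := by
    intro k x
    refine ediam_le fun y hy z hz => ?_
    rw [edist_dist]
    refine ENNReal.ofReal_le_ofReal ((hd k y z).2 ?_)
    exact (Near.equivalence h1 h2 k).trans ((Near.equivalence h1 h2 k).symm hy) hz
  refine (Measure.hausdorffMeasure_le_liminf_sum (ι := fun k => {p // p ∈ ι k}) (l := atTop) s univ
    (fun k : ℕ => ENNReal.ofReal (Real.exp (-(k : ℝ)))) ?_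
    (fun k p => {y | Near π₁ π₂ U₁ U₂ (p.1.2 : ℝ) p.1.1 y}) ?_ ?_).trans ?_
  · rw [← ENNReal.ofReal_zero]
    refine ENNReal.tendsto_ofReal ?_
    exact Real.tendsto_exp_neg_atTop_nhds_zero.comp tendsto_natCast_atTop_atTop
  · refine Eventually.of_forall fun k p => (hdiam _ _).trans ?_
    refine ENNReal.ofReal_le_ofReal (Real.exp_le_exp.2 (neg_le_neg ?_))
    exact_mod_cast hι1 k p.1 p.2
  · refine Eventually.of_forall fun k x _ => ?_
    obtain ⟨p, hp, hn⟩ := hι2 k x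
    exact mem_iUnion.2 ⟨⟨p, hp⟩, hn⟩
  · refine liminf_le_of_frequently_le' (Frequently.of_forall fun k => ?_)
    refine le_trans ?_ (ENNReal.ofReal_le_ofReal (hι3 k))
    rw [ENNReal.ofReal_sum_of_nonneg (fun _ _ => (Real.exp_pos _).le), ← Finset.sum_coe_sort (ι k)]
    refine Finset.sum_le_sum fun p _ => ?_
    refine (ENNReal.rpow_le_rpow (hdiam _ _) hs).trans (le_of_eq ?_)
    rw [ENNReal.ofReal_rpow_of_pos (Real.exp_pos _), ← Real.exp_mul]
    congr 2; ring

theorem F_finite {Λ Γ₁ Γ₂ : Type*} [Fintype Λ] [Nonempty Λ] {π₁ : Λ → Γ₁} {π₂ : Λ → Γ₂} {U₁ U₂ : (ℕ → Λ) → ℕ → ℝ}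
    {c C : ℝ} (h1 : Wt π₁ U₁ c C) (h2 : Wt π₂ U₂ c C)
    [MetricSpace (ℕ → Λ)] (hd : ∀ t (x y : ℕ → Λ), dist x y ≤ Real.exp (-t) ↔ Near π₁ π₂ U₁ U₂ t x y)
    [MeasurableSpace (ℕ → Λ)] [BorelSpace (ℕ → Λ)] : dimH (univ : Set (ℕ → Λ)) ≠ ⊤ := by
  classical
  obtain ⟨a0⟩ := ‹Nonempty Λ›
  have hcard : (1 : ℝ) ≤ Fintype.card Λ := by
    exact_mod_cast Nat.succ_le_of_lt (Fintype.card_pos_iff.2 ⟨a0⟩)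
  set L := Real.log (Fintype.card Λ) with hL
  have hL0 : 0 ≤ L := Real.log_nonneg hcard
  have hc := h1.cpos
  have key := F_cov h1 h2 hd (L / c) (Real.exp L) (by positivity) (by
    intro k
    have hP1 := Nat.le_ceil ((k : ℝ) / c)
    have hP2 := (Nat.ceil_lt_add_one (a := (k : ℝ) / c) (by positivity)).le
    set P := ⌈(k : ℝ) / c⌉₊
    let ext : (Fin P → Λ) → ℕ → Λ := fun x k => if h : k < P then x ⟨k, h⟩ else a0
    refine ⟨Finset.univ.image fun w => (ext w, k), ?_, ?_, ?_⟩
    · intro p hp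
      obtain ⟨q, hq, rfl⟩ := Finset.mem_image.1 hp
      exact le_rfl
    · intro x
      refine ⟨_, Finset.mem_image_of_mem _ (Finset.mem_univ fun j : Fin P => x j), ?_⟩
      have key : ∀ n : ℕ, c * n < (k : ℝ) → n < P := by
        intro n hn
        have : (n : ℝ) < k / c := by rwa [lt_div_iff₀' hc]
        exact_mod_cast this.trans_le hP1
      intro n
      refine ⟨fun hl => ?_, fun hl => ?_⟩
      · have := key n ((h1.lower _ n).trans_lt hl)
        simp [ext, this]
      · have := key n ((h2.lower _ n).trans_lt hl)
        simp [ext, this]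
    · have e1 : ∀ p ∈ Finset.univ.image fun w => (ext w, k), Real.exp (-(L / c * (p.2 : ℝ))) ≤ Real.exp (-(L / c * k)) := by
        intro p hp
        obtain ⟨q, hq, rfl⟩ := Finset.mem_image.1 hp
        exact le_rfl
      refine (Finset.sum_le_card_nsmul _ _ _ e1).trans ?_
      rw [nsmul_eq_mul]
      have e2 : ((Finset.univ.image fun w => (ext w, k)).card : ℝ) ≤ Real.exp (P * L) := by
        rw [Real.exp_nat_mul, hL, Real.exp_log (by linarith)]
        have : (Finset.univ.image fun w => (ext w, k)).card ≤ Fintype.card Λ ^ P :=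
          Finset.card_image_le.trans (by simp)
        exact_mod_cast this
      refine (mul_le_mul_of_nonneg_right e2 (Real.exp_pos _).le).trans ?_
      rw [← Real.exp_add]
      refine Real.exp_le_exp.2 ?_
      have := mul_le_mul_of_nonneg_right hP2 hL0
      have e4 : L / c * k = k / c * L := by ring
      rw [e4]
      linarith)
  have h6 : dimH (univ : Set (ℕ → Λ)) ≤ ((L / c).toNNReal : ℝ≥0∞) := by
    refine dimH_le_of_hausdorffMeasure_ne_top ?_
    rw [Real.coe_toNNReal _ (by positivity)]
    exact (key.trans_lt ENNReal.ofReal_lt_top).ne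
  exact (h6.trans_lt ENNReal.coe_lt_top).ne

theorem F_main {Λ Γ₁ Γ₂ : Type*} [Fintype Λ] [Nonempty Λ] {π₁ : Λ → Γ₁} {π₂ : Λ → Γ₂} {U₁ U₂ : (ℕ → Λ) → ℕ → ℝ}
    {c C : ℝ} (h1 : Wt π₁ U₁ c C) (h2 : Wt π₂ U₂ c C)
    (hinj : Function.Injective fun a => (π₁ a, π₂ a))
    [MetricSpace (ℕ → Λ)] (hd : ∀ t (x y : ℕ → Λ), dist x y ≤ Real.exp (-t) ↔ Near π₁ π₂ U₁ U₂ t x y)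
    [MeasurableSpace (ℕ → Λ)] [BorelSpace (ℕ → Λ)] (ε : ℝ) (hε : 0 < ε) :
    ∃ ν : Measure (ℕ → Λ), IsProbabilityMeasure ν ∧ Ergodic (fun ω k => ω (k + 1)) ν ∧
      dimH (univ : Set (ℕ → Λ)) - ENNReal.ofReal ε ≤ dimHMeasure ν := by
  have hfin := F_finite h1 h2 hd
  rcases le_or_gt (dimH (univ : Set (ℕ → Λ))) (ENNReal.ofReal ε) with hle | hlt
  · obtain ⟨ν, hν, he⟩ := F_any h1 h2 hinj hd
    refine ⟨ν, hν, he, ?_⟩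
    rw [tsub_eq_zero_of_le hle]; exact zero_le
  · set D := (dimH (univ : Set (ℕ → Λ))).toReal with hD
    have hDe : dimH (univ : Set (ℕ → Λ)) = ENNReal.ofReal D := (ENNReal.ofReal_toReal hfin).symm
    have hεD : ε < D := (ENNReal.ofReal_lt_iff_lt_toReal hε.le hfin).1 hlt
    have hs : 0 ≤ D - ε / 2 := by linarith
    have hk : ∃ k0 : ℕ, ∀ ι : Finset ((ℕ → Λ) × ℕ), (∀ p ∈ ι, k0 ≤ p.2) →
      (∀ x, ∃ p ∈ ι, Near π₁ π₂ U₁ U₂ (p.2 : ℝ) p.1 x) → 1 ≤ ∑ p ∈ ι, Real.exp (-((D - ε / 2) * p.2)) := by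
      by_contra hcon
      push Not at hcon
      have h7 := F_cov h1 h2 hd (D - ε / 2) 1 hs (fun k0 => by
        obtain ⟨ι, q1, q2, q3⟩ := hcon k0
        exact ⟨ι, q1, q2, q3.le⟩)
      have h8 : Measure.hausdorffMeasure ((D - ε / 2).toNNReal : ℝ) (univ : Set (ℕ → Λ)) = ⊤ := by
        refine hausdorffMeasure_of_lt_dimH ?_
        rw [hDe, ENNReal.ofReal, ENNReal.coe_lt_coe, ← NNReal.coe_lt_coe, Real.coe_toNNReal _ hs,
          Real.coe_toNNReal D (by linarith)]
        linarith
      have h9 : Measure.hausdorffMeasure (D - ε / 2) (univ : Set (ℕ → Λ)) = ⊤ := by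
        rwa [Real.coe_toNNReal _ hs] at h8
      rw [h9] at h7
      simp at h7
    obtain ⟨k0, hk0⟩ := hk
    have hfinal : ENNReal.ofReal (D - ε / 2 - ε / 2) = dimH (univ : Set (ℕ → Λ)) - ENNReal.ofReal ε := by
      rw [hDe, ← ENNReal.ofReal_sub _ hε.le]; congr 1; ring
    rw [← hfinal]
    rcases D_main h1 h2 (D - ε / 2) (ε / 2) hs (by linarith) k0 hk0 with hg | hg
    · exact F_build h1 h2 hinj hd _ (by linarith) hg
    · refine F_build h2 h1 ?_ (fun t x y => (hd t x y).trans Near.swap) _ (by linarith) hg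
      intro a a' h
      simp only [Prod.mk.injEq] at h
      exact hinj (by simp [h.1, h.2])


/-- On the symbolic space of a non-linear carpet there are shift-ergodic
probability measures of Hausdorff dimension arbitrarily close to that of the space. -/
theorem stmt4 {Λ₁ Λ₂ : Type} [Fintype Λ₁] [Fintype Λ₂] [Nonempty Λ₁] [Nonempty Λ₂]
    (F : ConformalIFS Λ₁) (G : ConformalIFS Λ₂)
    (A : Set (Λ₁ × Λ₂)) (hA : A.Nonempty)
    [MetricSpace (ℕ → ↥A)]
    (hdist : ∀ ω₁ ω₂ : ℕ → ↥A, dist ω₁ ω₂ = symbolicDist F G A ω₁ ω₂)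
    [MeasurableSpace (ℕ → ↥A)] [BorelSpace (ℕ → ↥A)]
    (ε : ℝ) (hε : 0 < ε) :
    ∃ ν : Measure (ℕ → ↥A), IsProbabilityMeasure ν ∧
      Ergodic (fun ω k => ω (k + 1)) ν ∧
      dimH (univ : Set (ℕ → ↥A)) - ENNReal.ofReal ε ≤ dimHMeasure ν := by
  have : Nonempty ↥A := hA.to_subtype
  have : Fintype ↥A := Fintype.ofFinite _
  obtain ⟨c₁, C₁, w1⟩ := ifs_wt F (fun a : ↥A => (a : Λ₁ × Λ₂).1)
  obtain ⟨c₂, C₂, w2⟩ := ifs_wt G (fun a : ↥A => (a : Λ₁ × Λ₂).2)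
  have hc : 0 < min c₁ c₂ := lt_min w1.cpos w2.cpos
  exact F_main (w1.enlarge hc (min_le_left _ _) (le_max_left C₁ C₂))
    (w2.enlarge hc (min_le_right _ _) (le_max_right C₁ C₂))
    (fun a a' h => by
      simp only [Prod.mk.injEq] at h
      exact Subtype.ext (Prod.ext h.1 h.2))
    (fun t x y => by rw [hdist]; exact symbolicDist_le_iff F G A x y t) ε hε

end
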